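/- Let n ≥ 2 be an integer. There exist a positive integer k, a real number c > 0, and a positive integer M (all depending only on n) such that for every positive integer a there exist a positive integer k' and real numbers c' > 0 and e > 0 (depending only on n and a) with the following property. Let K be a finite field with |K| > e and algebraic closure K̄; let P be a nonzero polynomial in the n² matrix-entry variables over K̄ of total degree at most a that does not vanish identically on SL_n; let T be a maximal torus of SL_n over K̄ and E ⊆ T(K); let A ⊆ SL_n(K) be a set generating SL_n(K); and let i ∈ {0,1,…,n}. Then at least one of the following holds: (1) there exist h₀ ∈ A_k and a subset E' ⊆ E_k with |E'| ≥ c·|E| such that for each t ∈ E' there are at least c'·|A| distinct tuples (κ(h₀g), κ(g), κ(tg), κ(t²g), …, κ(t^{i−1}g), κ(t^{i+1}g), …, κ(tⁿg)) ∈ (K^{n−1})^{n+1} arising from elements g ∈ A_{k'} satisfying P(h₀g) ≠ 0, P(g) ≠ 0, and P(t^m g) ≠ 0 for all m = 1,…,n; or (2) E is contained in the kernel of a nontrivial character of T whose exponents (m₁,…,m_n) satisfy |m_j| ≤ M for all j. -/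

import Mathlib

open Pointwise

/-- `A_r = (A ∪ A⁻¹ ∪ {1})^r`. -/
def prodSet {G : Type*} [Group G] (A : Set G) (r : ℕ) : Set G :=
  (A ∪ A⁻¹ ∪ {1}) ^ r

/-- The maximal torus `γ D γ⁻¹` of `SL_n(L)` determined by `γ ∈ GL_n(L)`, where `D` is
the set of diagonal matrices in `SL_n(L)`. -/
def torusOf (n : ℕ) (L : Type*) [Field L] (γ : (Matrix (Fin n) (Fin n) L)ˣ) :
    Set (Matrix.SpecialLinearGroup (Fin n) L) :=
  {x | ∃ d : Matrix (Fin n) (Fin n) L, d.IsDiag ∧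
    (x : Matrix (Fin n) (Fin n) L) = (γ : Matrix (Fin n) (Fin n) L) * d *
      ((γ⁻¹ : (Matrix (Fin n) (Fin n) L)ˣ) : Matrix (Fin n) (Fin n) L)}

/-- The value at `x` of the character of the torus `γ D γ⁻¹` with exponents `m`:
writing `x = γ·diag(x₁,…,x_n)·γ⁻¹`, it is `x₁^{m₁}⋯x_n^{m_n}`. -/
def charOf (n : ℕ) (L : Type*) [Field L] (γ : (Matrix (Fin n) (Fin n) L)ˣ)
    (m : Fin n → ℤ) (x : Matrix.SpecialLinearGroup (Fin n) L) : L :=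
  ∏ j : Fin n,
    ((((γ⁻¹ : (Matrix (Fin n) (Fin n) L)ˣ) : Matrix (Fin n) (Fin n) L) *
      (x : Matrix (Fin n) (Fin n) L) * (γ : Matrix (Fin n) (Fin n) L)) j j) ^ (m j)

/-- `κ(g) = (a_{n−1}, a_{n−2}, …, a₁)`, the tuple of middle coefficients of the
characteristic polynomial `det(λI − g) = λⁿ + a_{n−1}λ^{n−1} + ⋯ + a₁λ + (−1)ⁿ`. -/
noncomputable def kappa (n : ℕ) (K : Type*) [Field K] (g : Matrix.SpecialLinearGroup (Fin n) K) :
    Fin (n - 1) → K :=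
  fun j => (g : Matrix (Fin n) (Fin n) K).charpoly.coeff (n - 1 - (j : ℕ))

/-- The tuple `(κ(h₀g), κ(g), κ(tg), κ(t²g), …, κ(t^{i−1}g), κ(t^{i+1}g), …, κ(tⁿg))`
(the power `t^i` being omitted) as an element of `(K^{n−1})^{n+1}`. -/
noncomputable def kappaTuple (n : ℕ) (K : Type*) [Field K] (h₀ t : Matrix.SpecialLinearGroup (Fin n) K)
    (i : ℕ) (g : Matrix.SpecialLinearGroup (Fin n) K) : Fin (n + 1) → Fin (n - 1) → K :=
  fun m => if (m : ℕ) = 0 then kappa n K (h₀ * g)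
    else kappa n K (t ^ (if (m : ℕ) - 1 < i then (m : ℕ) - 1 else (m : ℕ)) * g)

/-- Evaluation of a polynomial in the matrix-entry variables over `K̄` at (the image in
`SL_n(K̄)` of) an element `x ∈ SL_n(K)`. -/
noncomputable def evalAt (n : ℕ) (K : Type*) [Field K]
    (P : MvPolynomial (Fin n × Fin n) (AlgebraicClosure K))
    (x : Matrix.SpecialLinearGroup (Fin n) K) : AlgebraicClosure K :=
  MvPolynomial.eval (fun q =>
    ((Matrix.SpecialLinearGroup.map (algebraMap K (AlgebraicClosure K)) x :
      Matrix.SpecialLinearGroup (Fin n) (AlgebraicClosure K)) :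
        Matrix (Fin n) (Fin n) (AlgebraicClosure K)) q.1 q.2) P

/-- `F` is given by a polynomial of total degree at most `d` in the matrix entries. -/
def PolyDeg {ι L : Type*} [Field L] (d : ℕ) (F : Matrix ι ι L → L) : Prop :=
  ∃ p : MvPolynomial (ι × ι) L, p.totalDegree ≤ d ∧
    ∀ x, F x = MvPolynomial.eval (fun q => x q.1 q.2) p

namespace PolyDeg

variable {ι L : Type*} [Field L] {d e : ℕ} {F G : Matrix ι ι L → L}

theorem mono (hF : PolyDeg d F) (h : d ≤ e) : PolyDeg e F := by
  obtain ⟨p, hp, hF⟩ := hF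
  exact ⟨p, hp.trans h, hF⟩

theorem const (c : L) : PolyDeg d (fun _ : Matrix ι ι L => c) :=
  ⟨MvPolynomial.C c, by simp, by simp⟩

theorem entry (a b : ι) : PolyDeg 1 (fun x : Matrix ι ι L => x a b) :=
  ⟨MvPolynomial.X (a, b), by simp, by simp⟩

theorem add (hF : PolyDeg d F) (hG : PolyDeg d G) : PolyDeg d (fun x => F x + G x) := by
  obtain ⟨p, hp, hF⟩ := hF
  obtain ⟨q, hq, hG⟩ := hG
  exact ⟨p + q, (MvPolynomial.totalDegree_add p q).trans (max_le hp hq), by simp [hF, hG]⟩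

theorem mul (hF : PolyDeg d F) (hG : PolyDeg e G) : PolyDeg (d + e) (fun x => F x * G x) := by
  obtain ⟨p, hp, hF⟩ := hF
  obtain ⟨q, hq, hG⟩ := hG
  exact ⟨p * q, (MvPolynomial.totalDegree_mul p q).trans (add_le_add hp hq), by simp [hF, hG]⟩

theorem const_mul (hF : PolyDeg d F) (c : L) : PolyDeg d (fun x => c * F x) := by
  simpa using (const (d := 0) c).mul hF

theorem pow (hF : PolyDeg d F) (k : ℕ) : PolyDeg (k * d) (fun x => F x ^ k) := by
  obtain ⟨p, hp, hF⟩ := hF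
  exact ⟨p ^ k, (MvPolynomial.totalDegree_pow p k).trans (Nat.mul_le_mul_left k hp),
    by simp [hF]⟩

theorem sum {κ : Type*} (s : Finset κ) {F : κ → Matrix ι ι L → L}
    (hF : ∀ l ∈ s, PolyDeg d (F l)) : PolyDeg d (fun x => ∑ l ∈ s, F l x) := by
  classical
  induction s using Finset.induction_on with
  | empty => simpa using const 0
  | insert a s ha ih =>
    simp only [Finset.sum_insert ha]
    exact (hF a (Finset.mem_insert_self a s)).add
      (ih fun l hl => hF l (Finset.mem_insert_of_mem hl))

theorem prod {κ : Type*} (s : Finset κ) {δ : κ → ℕ} {F : κ → Matrix ι ι L → L}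
    (hF : ∀ l ∈ s, PolyDeg (δ l) (F l)) :
    PolyDeg (∑ l ∈ s, δ l) (fun x => ∏ l ∈ s, F l x) := by
  classical
  induction s using Finset.induction_on with
  | empty => simpa using const 1
  | insert a s ha ih =>
    simp only [Finset.prod_insert ha, Finset.sum_insert ha]
    exact (hF a (Finset.mem_insert_self a s)).mul
      (ih fun l hl => hF l (Finset.mem_insert_of_mem hl))

theorem eval {κ : Type*} (p : MvPolynomial κ L) {F : κ → Matrix ι ι L → L}
    (hF : ∀ l, PolyDeg d (F l)) (hp : p.totalDegree ≤ e) :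
    PolyDeg (e * d) (fun x => MvPolynomial.eval (fun l => F l x) p) := by
  simp only [MvPolynomial.eval_eq]
  refine sum _ fun m hm => const_mul ?_ _
  refine (prod m.support (δ := fun l => m l * d) fun l _ => (hF l).pow _).mono ?_
  rw [← Finset.sum_mul]
  exact Nat.mul_le_mul_right d ((MvPolynomial.le_totalDegree hm).trans hp)

theorem comp (hF : PolyDeg e F) {M : Matrix ι ι L → Matrix ι ι L}
    (hM : ∀ a b, PolyDeg d (fun x => M x a b)) : PolyDeg (e * d) (fun x => F (M x)) := by
  obtain ⟨p, hp, hF⟩ := hF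
  simp only [hF]
  exact eval p (F := fun q x => M x q.1 q.2) (fun q => hM q.1 q.2) hp

theorem det {κ : Type*} [Fintype κ] [DecidableEq κ] {M : Matrix ι ι L → Matrix κ κ L}
    (hM : ∀ a b, PolyDeg d (fun x => M x a b)) :
    PolyDeg (Fintype.card κ * d) (fun x => (M x).det) := by
  simp only [Matrix.det_apply']
  refine sum _ fun s _ => const_mul ?_ _
  simpa using prod Finset.univ (δ := fun _ => d) fun l _ => hM (s l) l

variable [Fintype ι]

theorem matrix_mul {M N : Matrix ι ι L → Matrix ι ι L}
    (hM : ∀ a b, PolyDeg d (fun x => M x a b)) (hN : ∀ a b, PolyDeg e (fun x => N x a b))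
    (a b : ι) : PolyDeg (d + e) (fun x => (M x * N x) a b) := by
  simp only [Matrix.mul_apply]
  exact sum _ fun c _ => (hM a c).mul (hN c b)

theorem matrix_const_mul {M : Matrix ι ι L → Matrix ι ι L} (y : Matrix ι ι L)
    (hM : ∀ a b, PolyDeg d (fun x => M x a b)) (a b : ι) :
    PolyDeg d (fun x => (y * M x) a b) := by
  simpa using matrix_mul (M := fun _ => y) (d := 0) (fun a b => const _) hM a b

theorem matrix_mul_const {M : Matrix ι ι L → Matrix ι ι L} (y : Matrix ι ι L)
    (hM : ∀ a b, PolyDeg d (fun x => M x a b)) (a b : ι) :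
    PolyDeg d (fun x => (M x * y) a b) := by
  simpa using matrix_mul (N := fun _ => y) (e := 0) hM (fun a b => const _) a b

variable [DecidableEq ι]

theorem matrix_pow {M : Matrix ι ι L → Matrix ι ι L}
    (hM : ∀ a b, PolyDeg d (fun x => M x a b)) (k : ℕ) (a b : ι) :
    PolyDeg (k * d) (fun x => (M x ^ k) a b) := by
  induction k generalizing a b with
  | zero => simpa using const _
  | succ k ih =>
    simp only [pow_succ, Nat.succ_mul]
    exact matrix_mul ih hM a b

theorem charpoly_coeff (k : ℕ) :
    PolyDeg (Fintype.card ι) (fun x : Matrix ι ι L => x.charpoly.coeff k) := by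
  refine ⟨(Matrix.charpoly.univ L ι).coeff k, ?_, fun x => ?_⟩
  · rcases le_or_gt k (Fintype.card ι) with h | h
    · have := Matrix.charpoly.univ_coeff_isHomogeneous L ι k (Fintype.card ι - k) (by omega)
      exact this.totalDegree_le.trans (Nat.sub_le _ _)
    · rw [Polynomial.coeff_eq_zero_of_natDegree_lt]
      · simp
      · rwa [Matrix.charpoly.univ_natDegree]
  · have := Matrix.charpoly.univ_coeff_eval₂Hom ι (RingHom.id L) (fun q => x q.1 q.2) k
    exact this.symm

/-- Functions of bounded degree, pulled back along `ρ`, form a space of bounded dimension. -/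
theorem exists_submodule (X : Type*) (ρ : X → Matrix ι ι L) (d : ℕ) :
    ∃ V : Submodule L (X → L), Module.Finite L V ∧
      Module.finrank L V ≤ (d + 1) ^ (Fintype.card ι * Fintype.card ι) ∧
      ∀ f, f ∈ V ↔ ∃ F, PolyDeg d F ∧ f = fun x => F (ρ x) := by
  classical
  let W : Submodule L (X → L) := Submodule.span L
    (Set.range fun (m : ι × ι → Fin (d + 1)) (x : X) => ∏ q, ρ x q.1 q.2 ^ (m q : ℕ))
  let V : Submodule L (X → L) :=
    { carrier := {f | ∃ F, PolyDeg d F ∧ f = fun x => F (ρ x)}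
      add_mem' := by
        rintro _ _ ⟨F, hF, rfl⟩ ⟨G, hG, rfl⟩
        exact ⟨_, hF.add hG, rfl⟩
      zero_mem' := ⟨_, const 0, rfl⟩
      smul_mem' := by
        rintro c _ ⟨F, hF, rfl⟩
        exact ⟨_, hF.const_mul c, rfl⟩ }
  have hVW : V ≤ W := by
    rintro _ ⟨F, ⟨p, hp, hF⟩, rfl⟩
    have : (fun x => F (ρ x)) = ∑ m ∈ p.support, p.coeff m •
        fun x : X => ∏ q, ρ x q.1 q.2 ^ (m q) := by
      ext x
      simp [hF, MvPolynomial.eval_eq']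
    rw [this]
    refine Submodule.sum_mem _ fun m hm => Submodule.smul_mem _ _ (Submodule.subset_span ?_)
    refine ⟨fun q => ⟨m q, Nat.lt_succ_of_le ?_⟩, rfl⟩
    exact ((MvPolynomial.monomial_le_degreeOf q hm).trans
      (MvPolynomial.degreeOf_le_totalDegree p q)).trans hp
  have hWfin : Module.Finite L W := Module.Finite.span_of_finite L (Set.finite_range _)
  refine ⟨V, Submodule.finiteDimensional_of_le hVW, ?_, fun f => Iff.rfl⟩
  calc Module.finrank L V ≤ Module.finrank L W := Submodule.finrank_mono hVW
    _ ≤ Fintype.card (ι × ι → Fin (d + 1)) := finrank_range_le_card _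
    _ = _ := by simp

end PolyDeg

section prodSet

variable {G : Type*} [Group G] {A : Set G}

theorem one_mem_prodSet (A : Set G) (r : ℕ) : (1 : G) ∈ prodSet A r := by
  have := Set.pow_mem_pow (n := r) (show (1 : G) ∈ A ∪ A⁻¹ ∪ {1} by simp)
  rwa [one_pow] at this

theorem prodSet_mono (A : Set G) {r s : ℕ} (h : r ≤ s) : prodSet A r ⊆ prodSet A s :=
  Set.pow_subset_pow_right (by simp) h

theorem mul_mem_prodSet {x y : G} {r s : ℕ} (hx : x ∈ prodSet A r) (hy : y ∈ prodSet A s) :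
    x * y ∈ prodSet A (r + s) := by
  rw [prodSet, pow_add]
  exact Set.mul_mem_mul hx hy

theorem mem_prodSet_one {x : G} (hx : x ∈ A) : x ∈ prodSet A 1 := by
  simp [prodSet, hx]

end prodSet

/-- In a finite-dimensional space of functions, vanishing on a set is detected by a number of
points bounded by the dimension. -/
theorem exists_finset_detecting {X L : Type*} [Field L] (S : Set X) (d : ℕ) :
    ∀ V : Submodule L (X → L), Module.Finite L V → Module.finrank L V ≤ d →
      ∃ W : Finset X, W.card ≤ d ∧ (W : Set X) ⊆ S ∧
        ∀ f ∈ V, (∀ w ∈ W, f w = 0) → ∀ s ∈ S, f s = 0 := by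
  classical
  induction d with
  | zero =>
    intro V _ hV
    refine ⟨∅, by simp, by simp, fun f hf _ s _ => ?_⟩
    rw [Submodule.finrank_eq_zero.1 (Nat.le_zero.1 hV), Submodule.mem_bot] at hf
    simp [hf]
  | succ d ih =>
    intro V _ hV
    by_cases h : ∀ f ∈ V, ∀ s ∈ S, f s = 0
    · exact ⟨∅, by simp, by simp, fun f hf _ => h f hf⟩
    push Not at h
    obtain ⟨f, hf, s, hs, hfs⟩ := h
    let V' := V ⊓ LinearMap.ker (LinearMap.proj s : (X → L) →ₗ[L] L)
    have hlt : V' < V := lt_of_le_of_ne inf_le_left fun h => hfs (by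
      have : f ∈ V' := h ▸ hf
      exact this.2)
    obtain ⟨W, hWc, hWS, hW⟩ := ih V' (Submodule.finiteDimensional_of_le hlt.le)
      (by have := Submodule.finrank_lt_finrank_of_lt hlt; omega)
    refine ⟨insert s W, (Finset.card_insert_le _ _).trans (by omega), ?_, ?_⟩
    · simp [Set.insert_subset_iff, hs, hWS]
    · intro g hg hgW
      exact hW g ⟨hg, hgW s (Finset.mem_insert_self s W)⟩
        fun w hw => hgW w (Finset.mem_insert_of_mem hw)

/-- A translation-invariant space of functions of dimension at most `d` on which vanishing on
`prodSet A d` forces vanishing on the group generated by `A`. -/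
theorem eq_zero_of_forall_mem_prodSet {G L : Type*} [Group G] [Field L] (A : Set G) (d : ℕ)
    (V : Submodule L (G → L)) (hfin : Module.Finite L V) (hV : Module.finrank L V ≤ d)
    (hinv : ∀ f ∈ V, ∀ a : G, (fun x => f (x * a)) ∈ V) {f : G → L} (hf : f ∈ V)
    (hfA : ∀ w ∈ prodSet A d, f w = 0) : ∀ x ∈ Subgroup.closure A, f x = 0 := by
  let U : ℕ → Submodule L (G → L) := fun r =>
    { carrier := {f | f ∈ V ∧ ∀ w ∈ prodSet A r, f w = 0}
      add_mem' := fun ha hb => ⟨add_mem ha.1 hb.1, fun w hw => by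
        simp [ha.2 w hw, hb.2 w hw]⟩
      zero_mem' := ⟨zero_mem _, by simp⟩
      smul_mem' := fun c a ha => ⟨V.smul_mem c ha.1, fun w hw => by simp [ha.2 w hw]⟩ }
  have hanti : ∀ {r s}, r ≤ s → U s ≤ U r := fun h f hf =>
    ⟨hf.1, fun w hw => hf.2 w (prodSet_mono A h hw)⟩
  have hUV : ∀ r, U r ≤ V := fun r f hf => hf.1
  have hUfin : ∀ r, Module.Finite L (U r) := fun r => Submodule.finiteDimensional_of_le (hUV r)
  have hstab : ∃ r ≤ d, U r = U (r + 1) := by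
    by_contra! h
    have key : ∀ r ≤ d + 1, Module.finrank L (U r) + r ≤ d := by
      intro r hr
      induction r with
      | zero => simpa using (Submodule.finrank_mono (hUV 0)).trans hV
      | succ r ih =>
        have h1 := ih (by omega)
        have h2 := Submodule.finrank_lt_finrank_of_lt
          (show U (r + 1) < U r from
            lt_of_le_of_ne (hanti r.le_succ) (h r (by omega)).symm)
        omega
    have := key (d + 1) le_rfl
    omega
  obtain ⟨r, hrd, hr⟩ := hstab
  have hstep : ∀ a ∈ A ∪ A⁻¹, ∀ f ∈ U r, (fun x => f (x * a)) ∈ U r := by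
    intro a ha f hf
    refine ⟨hinv f hf.1 a, fun w hw => ?_⟩
    rw [hr] at hf
    exact hf.2 _ (mul_mem_prodSet hw (by simpa [prodSet] using Or.inr ha))
  have hclos : ∀ x ∈ Subgroup.closure A, ∀ f ∈ U r, (fun y => f (y * x)) ∈ U r := by
    intro x hx
    induction hx using Subgroup.closure_induction'' with
    | mem x hx => exact hstep x (Or.inl hx)
    | inv_mem x hx => exact hstep x⁻¹ (Or.inr (by simpa using hx))
    | one => simp
    | mul x y _ _ ihx ihy =>
      intro f hf
      simpa [mul_assoc] using ihx _ (ihy f hf)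
  intro x hx
  have := (hclos x hx f (hanti hrd ⟨hf, hfA⟩)).2 1 (one_mem_prodSet A r)
  simpa using this

/-- Bound for the dimension of the functions on `ι × ι` matrices of degree at most `d`. -/
def escapeBound (N d : ℕ) : ℕ := (d + 1) ^ (N * N)

theorem PolyDeg.exists_escape {ι L G : Type*} [Field L] [Fintype ι] [DecidableEq ι] [Group G]
    (ρ : G →* Matrix ι ι L) (A : Set G) (d : ℕ) :
    ∃ W : Finset G, W.card ≤ escapeBound (Fintype.card ι) d ∧
      (W : Set G) ⊆ prodSet A (escapeBound (Fintype.card ι) d) ∧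
      ∀ F, PolyDeg d F → (∀ w ∈ W, F (ρ w) = 0) → ∀ x ∈ Subgroup.closure A, F (ρ x) = 0 := by
  obtain ⟨V, hfin, hV, hmem⟩ := PolyDeg.exists_submodule G ρ d
  obtain ⟨W, hWc, hWA, hW⟩ :=
    exists_finset_detecting (prodSet A (escapeBound (Fintype.card ι) d)) _ V hfin hV
  refine ⟨W, hWc, hWA, fun F hF hFW => ?_⟩
  have hFV : (fun x => F (ρ x)) ∈ V := (hmem _).2 ⟨F, hF, rfl⟩
  refine eq_zero_of_forall_mem_prodSet A _ V hfin hV ?_ hFV (hW _ hFV hFW)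
  intro f hf a
  obtain ⟨F, hF, rfl⟩ := (hmem _).1 hf
  refine (hmem _).2 ⟨fun x => F (x * ρ a), ?_, by simp⟩
  simpa using hF.comp (M := fun x => x * ρ a) (matrix_mul_const _ PolyDeg.entry)

/-- Pigeonhole: if every element of `S` is related to some element of `W`, then some element of
`W` is related to a proportion at least `1 / D` of `S`. -/
theorem exists_card_le_mul_ncard {X Y : Type*} (S : Set X) (hS : S.Finite) (W : Finset Y) (D : ℕ)
    (hW : W.card ≤ D) (hD : W.Nonempty) (R : X → Y → Prop) (h : ∀ x ∈ S, ∃ w ∈ W, R x w) :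
    ∃ w ∈ W, S.ncard ≤ D * {x ∈ S | R x w}.ncard := by
  classical
  by_contra! hlt
  have h1 : S ⊆ ⋃ w ∈ W, {x ∈ S | R x w} := fun x hx => by
    obtain ⟨w, hw, hR⟩ := h x hx
    exact Set.mem_biUnion hw ⟨hx, hR⟩
  have hfin : ∀ w, {x ∈ S | R x w}.Finite := fun w => hS.subset (Set.sep_subset _ _)
  have h2 : S.ncard ≤ ∑ w ∈ W, {x ∈ S | R x w}.ncard :=
    (Set.ncard_le_ncard h1 (W.finite_toSet.biUnion fun w _ => hfin w)).trans
      (Finset.set_ncard_biUnion_le _ _)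
  have h3 : ∑ w ∈ W, D * {x ∈ S | R x w}.ncard < ∑ _w ∈ W, S.ncard :=
    Finset.sum_lt_sum_of_nonempty hD hlt
  rw [← Finset.mul_sum, Finset.sum_const, smul_eq_mul] at h3
  have h4 : W.card * S.ncard ≤ D * S.ncard := Nat.mul_le_mul_right _ hW
  have h5 : D * S.ncard ≤ D * ∑ w ∈ W, {x ∈ S | R x w}.ncard := Nat.mul_le_mul_left _ h2
  omega

section transvections

open Matrix Matrix.SpecialLinearGroup

variable {ι L : Type*} [Field L]

/-- Restriction of a polynomial function to a polynomial curve of matrices. -/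
theorem PolyDeg.exists_polynomial {d e : ℕ} {F : Matrix ι ι L → L} (hF : PolyDeg d F)
    (c : Matrix ι ι (Polynomial L)) (hc : ∀ a b, (c a b).natDegree ≤ e) :
    ∃ p : Polynomial L, p.natDegree ≤ d * e ∧ ∀ s, F (c.map (Polynomial.eval s)) = p.eval s := by
  obtain ⟨q, hq, hF⟩ := hF
  refine ⟨MvPolynomial.aeval (fun r : ι × ι => c r.1 r.2) q, ?_, fun s => ?_⟩
  · exact (MvPolynomial.aeval_natDegree_le q hq _ fun r => hc r.1 r.2)
  · rw [hF, ← Polynomial.coe_evalRingHom, MvPolynomial.aeval_def, MvPolynomial.hom_eval₂]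
    have : (Polynomial.evalRingHom s).comp (algebraMap L (Polynomial L)) = RingHom.id L := by
      ext; simp
    rw [this, MvPolynomial.eval₂_id]
    rfl

variable [Fintype ι] [DecidableEq ι]

theorem diag2n_eq_prod_transvection {i j : ι} (hij : i ≠ j) {c : L} (hc : c ≠ 0) :
    diag2n hij c hc =
      transvection hij c * transvection hij.symm (-c⁻¹) * transvection hij c *
        (transvection hij (-1) * transvection hij.symm 1 * transvection hij (-1)) := by
  apply Subtype.ext
  have h1 : (transvection hij c * transvection hij.symm (-c⁻¹) * transvection hij c).1 =
      1 - single i i (1 : L) - single j j 1 + single i j c - single j i c⁻¹ := by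
    simp only [coe_mul, transvection_coe, mul_add, add_mul, one_mul, mul_one,
      single_mul_single_same, single_mul_single_of_ne _ _ _ _ hij.symm, mul_neg, neg_mul,
      mul_inv_cancel₀ hc, inv_mul_cancel₀ hc, ← single_neg]
    abel
  have h2 : (transvection hij (-1 : L) * transvection hij.symm (1 : L) *
      transvection hij (-1 : L)).1 =
      1 - single i i (1 : L) - single j j 1 - single i j 1 + single j i 1 := by
    simp only [coe_mul, transvection_coe, mul_add, add_mul, one_mul, mul_one,
      single_mul_single_same, single_mul_single_of_ne _ _ _ _ hij.symm, mul_neg, neg_mul, ← single_neg]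
    abel
  have h3 : (diag2n hij c hc).1 =
      1 - single i i (1 : L) - single j j 1 + single i i c + single j j c⁻¹ := by
    rw [diag2n_coe]
    ext a b
    rcases eq_or_ne a b with rfl | hab
    · rcases eq_or_ne a i with rfl | hai
      · simp [hij.symm]
      · rcases eq_or_ne a j with rfl | haj
        · simp [hij, hij.symm]
        · simp [hai.symm, haj.symm, hai, haj]
    · have : ∀ k : ι, ¬ (k = a ∧ k = b) := fun k h => hab (h.1 ▸ h.2)
      simp [hab, this]
  rw [coe_mul, h1, h2, h3]
  simp only [mul_add, mul_sub, add_mul, sub_mul, one_mul, mul_one, single_mul_single_same,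
      single_mul_single_of_ne _ _ _ _ hij,
    single_mul_single_of_ne _ _ _ _ hij.symm]
  abel

theorem transvection_induction [Nontrivial ι] (P : SpecialLinearGroup ι L → Prop)
    (htransvec : ∀ (i j : ι) (hij : i ≠ j) (a : L), P (transvection hij a))
    (hmul : ∀ A B, P A → P B → P (A * B)) (M : SpecialLinearGroup ι L) : P M := by
  refine diagonal_transvection_induction' P M (fun i j hij c hc => ?_) htransvec hmul
  rw [diag2n_eq_prod_transvection]
  exact hmul _ _ (hmul _ _ (hmul _ _ (htransvec _ _ _ _) (htransvec _ _ _ _)) (htransvec _ _ _ _))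
    (hmul _ _ (hmul _ _ (htransvec _ _ _ _) (htransvec _ _ _ _)) (htransvec _ _ _ _))

theorem map_transvection {R S : Type*} [CommRing R] [CommRing S] (f : R →+* S) {i j : ι}
    (hij : i ≠ j) (a : R) :
    SpecialLinearGroup.map f (transvection hij a) = transvection hij (f a) := by
  apply Subtype.ext
  rw [map_apply_coe, transvection_coe, transvection_coe, map_add, map_one]
  congr 1
  exact map_single i j a f

/-- A polynomial function of degree less than `|K|` vanishing on `SL(K)` vanishes on `SL(L)`. -/
theorem PolyDeg.eq_zero_of_forall_map [Nontrivial ι] {K : Type*} [Field K] [Fintype K]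
    [Algebra K L] {d : ℕ} (hd : d < Fintype.card K) {F : Matrix ι ι L → L} (hF : PolyDeg d F)
    (h : ∀ x : SpecialLinearGroup ι K, F (SpecialLinearGroup.map (algebraMap K L) x) = 0)
    (z : SpecialLinearGroup ι L) : F z = 0 := by
  suffices H : ∀ z : SpecialLinearGroup ι L, ∀ F : Matrix ι ι L → L, PolyDeg d F →
      (∀ x : SpecialLinearGroup ι K, F (SpecialLinearGroup.map (algebraMap K L) x) = 0) →
      ∀ x : SpecialLinearGroup ι K, F ((SpecialLinearGroup.map (algebraMap K L) x).1 * z.1) = 0 by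
    simpa using H z F hF h 1
  refine transvection_induction _ ?_ ?_
  · intro i j hij a F hF h x
    obtain ⟨p, hp, hpF⟩ := hF.exists_polynomial (e := 1)
      ((SpecialLinearGroup.map (algebraMap K L) x).1.map Polynomial.C * (1 + single i j Polynomial.X)) (by
        intro a b
        rw [mul_apply]
        refine Polynomial.natDegree_sum_le_of_forall_le _ _ fun c _ => ?_
        rw [map_apply]
        refine (Polynomial.natDegree_C_mul_le _ _).trans ?_
        rw [Matrix.add_apply]
        refine (Polynomial.natDegree_add_le _ _).trans (max_le ?_ ?_)
        · rw [one_apply]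
          split_ifs <;> simp
        · rw [single_apply]
          split_ifs <;> simp)
    have hcurve : ∀ s : L, ((SpecialLinearGroup.map (algebraMap K L) x).1.map Polynomial.C *
        (1 + single i j Polynomial.X)).map (Polynomial.eval s) =
          (SpecialLinearGroup.map (algebraMap K L) x).1 * (transvection hij s).1 := by
      intro s
      rw [← Polynomial.coe_evalRingHom, ← RingHom.mapMatrix_apply, _root_.map_mul, transvection_coe,
        map_add, map_one]
      congr 1
      · ext; simp
      · congr 1
        exact map_single i j Polynomial.X (Polynomial.evalRingHom s) |>.trans (by simp)
    have hp0 : p = 0 := by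
      refine Polynomial.eq_zero_of_natDegree_lt_card_of_eval_eq_zero p
        (f := algebraMap K L) (algebraMap K L).injective (fun s => ?_) (by omega)
      rw [← hpF, hcurve]
      have := h (x * transvection hij s)
      rw [_root_.map_mul, coe_mul] at this
      rwa [map_transvection] at this
    rw [← hcurve, hpF, hp0, Polynomial.eval_zero]
  · intro A B hA hB F hF h x
    have := hA (fun y => F (y * B)) (by
      simpa using hF.comp (M := fun y => y * B.1) (matrix_mul_const _ PolyDeg.entry)) (hB F hF h) x
    rwa [mul_assoc] at this

theorem exists_curve [Nontrivial ι] (z : SpecialLinearGroup ι L) :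
    ∃ c : SpecialLinearGroup ι (Polynomial L),
      SpecialLinearGroup.map (Polynomial.evalRingHom 0) c = 1 ∧ SpecialLinearGroup.map (Polynomial.evalRingHom 1) c = z := by
  refine transvection_induction (fun z => ∃ c : SpecialLinearGroup ι (Polynomial L),
    SpecialLinearGroup.map (Polynomial.evalRingHom 0) c = 1 ∧
      SpecialLinearGroup.map (Polynomial.evalRingHom 1) c = z) ?_ ?_ z
  · intro i j hij a
    exact ⟨transvection hij (Polynomial.C a * Polynomial.X), by simp [map_transvection],
      by simp [map_transvection]⟩
  · rintro A B ⟨c, hc0, hc1⟩ ⟨c', hc0', hc1'⟩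
    exact ⟨c * c', by simp [hc0, hc0'], by simp [hc1, hc1']⟩

/-- `SL(L)` is irreducible over an infinite field. -/
theorem PolyDeg.exists_mul_ne_zero [Nontrivial ι] [Infinite L] {d e : ℕ} {F G : Matrix ι ι L → L}
    (hF : PolyDeg d F) (hG : PolyDeg e G) (hF0 : ∃ x : SpecialLinearGroup ι L, F x ≠ 0)
    (hG0 : ∃ x : SpecialLinearGroup ι L, G x ≠ 0) :
    ∃ x : SpecialLinearGroup ι L, F x * G x ≠ 0 := by
  obtain ⟨x, hx⟩ := hF0
  obtain ⟨y, hy⟩ := hG0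
  obtain ⟨c, hc0, hc1⟩ := exists_curve (x⁻¹ * y)
  let c' := SpecialLinearGroup.map Polynomial.C x * c
  have hc' : ∀ s, c'.1.map (Polynomial.eval s) =
      (x * SpecialLinearGroup.map (Polynomial.evalRingHom s) c : SpecialLinearGroup ι L).1 := by
    intro s
    have : x = SpecialLinearGroup.map (Polynomial.evalRingHom s) (SpecialLinearGroup.map Polynomial.C x) := by ext; simp
    conv_rhs => rw [this, ← _root_.map_mul]
    rfl
  have hdeg : ∃ N, ∀ a b, (c'.1 a b).natDegree ≤ N :=
    ⟨∑ a, ∑ b, (c'.1 a b).natDegree, fun a b =>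
      (Finset.single_le_sum (f := fun b => (c'.1 a b).natDegree)
        (fun _ _ => Nat.zero_le _) (Finset.mem_univ b)).trans
      (Finset.single_le_sum (f := fun a => ∑ b, (c'.1 a b).natDegree)
        (fun _ _ => Nat.zero_le _) (Finset.mem_univ a))⟩
  obtain ⟨N, hN⟩ := hdeg
  obtain ⟨p, -, hp⟩ := hF.exists_polynomial c'.1 hN
  obtain ⟨q, -, hq⟩ := hG.exists_polynomial c'.1 hN
  have hp0 : p ≠ 0 := by
    rintro rfl
    have := hp 0
    rw [hc', hc0, mul_one, Polynomial.eval_zero] at this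
    exact hx this
  have hq0 : q ≠ 0 := by
    rintro rfl
    have := hq 1
    rw [hc', hc1, mul_inv_cancel_left, Polynomial.eval_zero] at this
    exact hy this
  obtain ⟨s, hs⟩ := Polynomial.exists_eval_ne_zero_of_natDegree_lt_card (p * q)
    (mul_ne_zero hp0 hq0) (Cardinal.natCast_lt_aleph0.trans_le (Cardinal.aleph0_le_mk L))
  refine ⟨x * SpecialLinearGroup.map (Polynomial.evalRingHom s) c, ?_⟩
  rwa [← hc', hp, hq, ← Polynomial.eval_mul]

theorem PolyDeg.exists_prod_ne_zero [Nontrivial ι] [Infinite L] {κ : Type*} (s : Finset κ)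
    {d : κ → ℕ} {F : κ → Matrix ι ι L → L} (hF : ∀ l ∈ s, PolyDeg (d l) (F l))
    (h : ∀ l ∈ s, ∃ x : SpecialLinearGroup ι L, F l x ≠ 0) :
    ∃ x : SpecialLinearGroup ι L, ∏ l ∈ s, F l x ≠ 0 := by
  classical
  induction s using Finset.induction_on with
  | empty => exact ⟨1, by simp⟩
  | insert a s ha ih =>
    simp only [Finset.prod_insert ha]
    have hs : ∀ l ∈ s, PolyDeg (d l) (F l) := fun l hl => hF l (Finset.mem_insert_of_mem hl)
    exact (hF a (Finset.mem_insert_self a s)).exists_mul_ne_zero (PolyDeg.prod s hs)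
      (h a (Finset.mem_insert_self a s)) (ih hs fun l hl => h l (Finset.mem_insert_of_mem hl))

end transvections

/-- A linear relation between multiplicative characters holds for any values compatible with the
coincidences between the characters. -/
theorem sum_mul_eq_zero_of_monoidHom {σ H L : Type*} [Group H] [Field L] (s : Finset σ)
    (φ : σ → (H →* L)) (c : σ → L) (h : ∀ y, ∑ m ∈ s, c m * φ m y = 0) (a : σ → L)
    (ha : ∀ m ∈ s, ∀ m' ∈ s, φ m = φ m' → a m = a m') : ∑ m ∈ s, c m * a m = 0 := by
  classical
  have hfib : ∀ f : σ → L, ∑ m ∈ s, f m = ∑ χ ∈ s.image φ, ∑ m ∈ s with φ m = χ, f m :=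
    fun f => (Finset.sum_fiberwise_of_maps_to (fun m hm => Finset.mem_image_of_mem _ hm) f).symm
  have hind := linearIndependent_iff'.1 (linearIndependent_monoidHom H L)
    (s.image φ) (fun χ => ∑ m ∈ s with φ m = χ, c m) (by
      ext y
      have := h y
      rw [hfib] at this
      rw [Finset.sum_apply, Pi.zero_apply, ← this]
      refine Finset.sum_congr rfl fun χ _ => ?_
      rw [Pi.smul_apply, smul_eq_mul, Finset.sum_mul]
      refine Finset.sum_congr rfl fun m hm => ?_
      rw [(Finset.mem_filter.1 hm).2])
  rw [hfib]
  refine Finset.sum_eq_zero fun χ hχ => ?_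
  obtain ⟨m₀, hm₀, rfl⟩ := Finset.mem_image.1 hχ
  calc ∑ m ∈ s with φ m = φ m₀, c m * a m
      = ∑ m ∈ s with φ m = φ m₀, c m * a m₀ := by
        refine Finset.sum_congr rfl fun m hm => ?_
        rw [ha m (Finset.mem_filter.1 hm).1 m₀ hm₀ (Finset.mem_filter.1 hm).2]
    _ = 0 := by rw [← Finset.sum_mul, hind _ hχ, zero_mul]

section torus

variable {n : ℕ} {L : Type*} [Field L] {γ : (Matrix (Fin n) (Fin n) L)ˣ}

theorem mem_torusOf_iff {x : Matrix.SpecialLinearGroup (Fin n) L} :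
    x ∈ torusOf n L γ ↔ ∃ v : Fin n → L, x.1 = γ.1 * Matrix.diagonal v * γ⁻¹.1 := by
  constructor
  · rintro ⟨d, hd, hx⟩
    exact ⟨d.diag, by rw [hd.diagonal_diag]; exact hx⟩
  · rintro ⟨v, hx⟩
    exact ⟨Matrix.diagonal v, Matrix.isDiag_diagonal v, hx⟩

/-- The diagonal entries of `γ⁻¹ x γ`. -/
def torusCoord (γ : (Matrix (Fin n) (Fin n) L)ˣ) (x : Matrix.SpecialLinearGroup (Fin n) L)
    (j : Fin n) : L :=
  (γ⁻¹.1 * x.1 * γ.1) j j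

theorem torusCoord_eq {x : Matrix.SpecialLinearGroup (Fin n) L} {v : Fin n → L}
    (hx : x.1 = γ.1 * Matrix.diagonal v * γ⁻¹.1) : torusCoord γ x = v := by
  ext j
  have : γ⁻¹.1 * x.1 * γ.1 = Matrix.diagonal v := by
    rw [hx]
    simp only [mul_assoc, Units.inv_mul, mul_one, Units.inv_mul_cancel_left]
  rw [torusCoord, this, Matrix.diagonal_apply_eq]

theorem eq_conj_torusCoord {x : Matrix.SpecialLinearGroup (Fin n) L} (hx : x ∈ torusOf n L γ) :
    x.1 = γ.1 * Matrix.diagonal (torusCoord γ x) * γ⁻¹.1 := by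
  obtain ⟨v, hv⟩ := mem_torusOf_iff.1 hx
  rwa [torusCoord_eq hv]

theorem prod_torusCoord {x : Matrix.SpecialLinearGroup (Fin n) L} (hx : x ∈ torusOf n L γ) :
    ∏ j, torusCoord γ x j = 1 := by
  have := x.2
  rw [eq_conj_torusCoord hx, Matrix.det_mul, Matrix.det_mul, mul_right_comm, ← Matrix.det_mul,
    Units.mul_inv, Matrix.det_one, one_mul, Matrix.det_diagonal] at this
  exact this

theorem torusCoord_ne_zero {x : Matrix.SpecialLinearGroup (Fin n) L} (hx : x ∈ torusOf n L γ)
    (j : Fin n) : torusCoord γ x j ≠ 0 := fun h => by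
  have := prod_torusCoord hx
  rw [Finset.prod_eq_zero (Finset.mem_univ j) h] at this
  exact zero_ne_one this

theorem mul_eq_conj {x y : Matrix.SpecialLinearGroup (Fin n) L} {v w : Fin n → L}
    (hx : x.1 = γ.1 * Matrix.diagonal v * γ⁻¹.1) (hy : y.1 = γ.1 * Matrix.diagonal w * γ⁻¹.1) :
    (x * y).1 = γ.1 * Matrix.diagonal (v * w) * γ⁻¹.1 := by
  rw [Matrix.SpecialLinearGroup.coe_mul, hx, hy]
  have : Matrix.diagonal (v * w) = Matrix.diagonal v * Matrix.diagonal w := by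
    rw [Matrix.diagonal_mul_diagonal]; rfl
  rw [this]
  simp only [mul_assoc, Units.inv_mul_cancel_left]

variable (γ) in
/-- The torus as a subgroup. -/
def torusSubgroup : Subgroup (Matrix.SpecialLinearGroup (Fin n) L) where
  carrier := torusOf n L γ
  mul_mem' {x y} hx hy := by
    obtain ⟨v, hv⟩ := mem_torusOf_iff.1 hx
    obtain ⟨w, hw⟩ := mem_torusOf_iff.1 hy
    exact mem_torusOf_iff.2 ⟨_, mul_eq_conj hv hw⟩
  one_mem' := mem_torusOf_iff.2 ⟨1, by simp⟩
  inv_mem' {x} hx := by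
    refine mem_torusOf_iff.2 ⟨fun j => (torusCoord γ x j)⁻¹, ?_⟩
    set y : Matrix (Fin n) (Fin n) L :=
      γ.1 * Matrix.diagonal (fun j => (torusCoord γ x j)⁻¹) * γ⁻¹.1 with hy
    have hxy : x.1 * y = 1 := by
      rw [eq_conj_torusCoord hx, hy]
      simp only [mul_assoc, Units.inv_mul_cancel_left]
      rw [← mul_assoc (Matrix.diagonal _), Matrix.diagonal_mul_diagonal]
      simp [mul_inv_cancel₀ (torusCoord_ne_zero hx _)]
    calc x⁻¹.1 = x⁻¹.1 * (x.1 * y) := by rw [hxy, mul_one]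
      _ = (x⁻¹ * x).1 * y := by rw [← mul_assoc]; rfl
      _ = y := by simp

theorem torusCoord_mul {x y : Matrix.SpecialLinearGroup (Fin n) L} (hx : x ∈ torusOf n L γ)
    (hy : y ∈ torusOf n L γ) : torusCoord γ (x * y) = torusCoord γ x * torusCoord γ y :=
  torusCoord_eq (mul_eq_conj (eq_conj_torusCoord hx) (eq_conj_torusCoord hy))

variable (γ) in
/-- The character of the torus with exponents `m`. -/
def torusChar (m : Fin n → ℕ) : torusSubgroup γ →* L where
  toFun x := ∏ j, torusCoord γ x.1 j ^ m j
  map_one' := by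
    have : torusCoord γ 1 = 1 := torusCoord_eq (by simp)
    simp [this]
  map_mul' x y := by
    simp [torusCoord_mul x.2 y.2, mul_pow, Finset.prod_mul_distrib]

theorem charOf_sub_eq_one_iff {x : Matrix.SpecialLinearGroup (Fin n) L} (hx : x ∈ torusOf n L γ)
    (m m' : Fin n → ℕ) :
    charOf n L γ (fun j => (m j : ℤ) - m' j) x = 1 ↔
      torusChar γ m ⟨x, hx⟩ = torusChar γ m' ⟨x, hx⟩ := by
  have h : charOf n L γ (fun j => (m j : ℤ) - m' j) x =
      (∏ j, torusCoord γ x j ^ m j) / ∏ j, torusCoord γ x j ^ m' j := by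
    rw [← Finset.prod_div_distrib]
    refine Finset.prod_congr rfl fun j _ => ?_
    exact (zpow_sub₀ (torusCoord_ne_zero hx j) _ _).trans (by simp)
  rw [h, div_eq_one_iff_eq (Finset.prod_ne_zero_iff.2 fun j _ =>
    pow_ne_zero _ (torusCoord_ne_zero hx j))]
  rfl

/-- Restriction of a polynomial function to the diagonal matrices. -/
theorem PolyDeg.exists_eval_diagonal {d : ℕ} {F : Matrix (Fin n) (Fin n) L → L}
    (hF : PolyDeg d F) : ∃ (s : Finset (Fin n × Fin n →₀ ℕ)) (c : (Fin n × Fin n →₀ ℕ) → L),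
      (∀ m ∈ s, ∀ q, m q ≤ d) ∧
      ∀ v : Fin n → L, F (Matrix.diagonal v) = ∑ m ∈ s, c m * ∏ j, v j ^ m (j, j) := by
  obtain ⟨p, hp, hF⟩ := hF
  refine ⟨p.support,
    fun m => p.coeff m * ∏ a, ∏ b ∈ Finset.univ.erase a, (0 : L) ^ m (a, b), fun m hm q => ?_,
    fun v => ?_⟩
  · exact ((MvPolynomial.monomial_le_degreeOf q hm).trans
      (MvPolynomial.degreeOf_le_totalDegree p q)).trans hp
  · rw [hF, MvPolynomial.eval_eq']
    refine Finset.sum_congr rfl fun m _ => ?_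
    rw [mul_assoc, ← Finset.prod_mul_distrib, Fintype.prod_prod_type]
    congr 1
    refine Finset.prod_congr rfl fun a _ => ?_
    rw [← Finset.prod_erase_mul _ _ (Finset.mem_univ a), Matrix.diagonal_apply_eq]
    congr 1
    refine Finset.prod_congr rfl fun b hb => ?_
    rw [Matrix.diagonal_apply_ne _ (Finset.ne_of_mem_erase hb).symm]

/-- If no nontrivial character with small exponents kills `E ⊆ T`, a polynomial function of small
degree which is nonzero on `T` is nonzero on the group generated by `E`. -/
theorem exists_mem_closure_ne_zero {G : Type*} [Group G]
    (ρ : G →* Matrix.SpecialLinearGroup (Fin n) L) {E : Set G}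
    (hE : ∀ x ∈ E, ρ x ∈ torusOf n L γ) {d M : ℕ} (hdM : d ≤ M)
    (hchar : ¬ ∃ m : Fin n → ℤ, (∃ x ∈ torusOf n L γ, charOf n L γ m x ≠ 1) ∧
      (∀ j, (m j).natAbs ≤ M) ∧ ∀ t ∈ E, charOf n L γ m (ρ t) = 1)
    {F : Matrix (Fin n) (Fin n) L → L} (hF : PolyDeg d F)
    {x : Matrix.SpecialLinearGroup (Fin n) L} (hx : x ∈ torusOf n L γ) (hFx : F x.1 ≠ 0) :
    ∃ y ∈ Subgroup.closure E, F (ρ y).1 ≠ 0 := by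
  classical
  by_contra! hzero
  have hcl : Subgroup.closure E ≤ (torusSubgroup γ).comap ρ := (Subgroup.closure_le _).2 hE
  have hF' : PolyDeg d fun y => F (γ.1 * y * γ⁻¹.1) :=
    (hF.comp (M := fun y => γ.1 * y * γ⁻¹.1) (d := 1)
      (PolyDeg.matrix_mul_const _ (PolyDeg.matrix_const_mul _ PolyDeg.entry))).mono (by simp)
  obtain ⟨s, c, hs, hc⟩ := hF'.exists_eval_diagonal
  let τ : Subgroup.closure E →* torusSubgroup γ :=
    (ρ.comp (Subgroup.closure E).subtype).codRestrict (torusSubgroup γ) fun y => hcl y.2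
  let e : (Fin n × Fin n →₀ ℕ) → Fin n → ℕ := fun m j => m (j, j)
  let φ : (Fin n × Fin n →₀ ℕ) → (Subgroup.closure E →* L) := fun m => (torusChar γ (e m)).comp τ
  have hFT : ∀ y : torusSubgroup γ, F y.1.1 = ∑ m ∈ s, c m * torusChar γ (e m) y := by
    intro y
    rw [eq_conj_torusCoord y.2, hc]
    rfl
  have hφ : ∀ m ∈ s, ∀ m' ∈ s, φ m = φ m' →
      torusChar γ (e m) ⟨x, hx⟩ = torusChar γ (e m') ⟨x, hx⟩ := by
    intro m hm m' hm' h
    rw [← charOf_sub_eq_one_iff hx]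
    by_contra hne
    refine hchar ⟨_, ⟨x, hx, hne⟩, fun j => ?_, fun t ht => ?_⟩
    · have := hs m hm (j, j)
      have := hs m' hm' (j, j)
      simp only [e]
      omega
    · rw [charOf_sub_eq_one_iff (hE t ht)]
      have := DFunLike.congr_fun h (⟨t, Subgroup.subset_closure ht⟩ : Subgroup.closure E)
      simp only [φ, MonoidHom.comp_apply] at this
      have hτ : τ ⟨t, Subgroup.subset_closure ht⟩ = ⟨ρ t, hE t ht⟩ := rfl
      rwa [hτ] at this
  refine hFx ?_
  rw [hFT ⟨x, hx⟩]
  refine sum_mul_eq_zero_of_monoidHom s φ c (fun y => ?_)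
    (fun m => torusChar γ (e m) ⟨x, hx⟩) hφ
  have h0 : F (τ y).1.1 = 0 := hzero y.1 y.2
  rw [← h0, hFT (τ y)]
  simp only [φ, MonoidHom.comp_apply]

end torus

section algebraicIndependence

open MvPolynomial

theorem aeval_mul_of_isHomogeneous {κ L S : Type*} [CommSemiring L] [CommSemiring S] [Algebra L S]
    {φ : MvPolynomial κ L} {k : ℕ} (hφ : φ.IsHomogeneous k) (x : S) (v : κ → S) :
    aeval (fun l => x * v l) φ = x ^ k * aeval v φ := by
  rw [aeval_def, aeval_def, eval₂_eq, eval₂_eq, Finset.mul_sum]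
  refine Finset.sum_congr rfl fun m hm => ?_
  have : ∑ i ∈ m.support, m i = k := by
    rw [← hφ (mem_support_iff.1 hm), Finsupp.weight_apply, Finsupp.sum]
    simp
  simp only [mul_pow, Finset.prod_mul_distrib]
  rw [Finset.prod_pow_eq_pow_sum, this]
  ring

/-- Functions whose first-order expansions at one point have a surjective linear part are
algebraically independent. -/
theorem eq_zero_of_eval_eq_zero_of_surjective {κ Y Δ L : Type*} [Finite κ] [Field L] [Infinite L]
    (f : κ → Y → L) (line : Δ → L → Y) (f₀ : κ → L) (v : Δ → κ → Polynomial L)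
    (hf : ∀ δ l ε, f l (line δ ε) = f₀ l + ε * (v δ l).eval ε)
    (hsurj : ∀ y : κ → L, ∃ δ, ∀ l, (v δ l).eval 0 = y l) (Q : MvPolynomial κ L)
    (hQ : ∀ x, eval (fun l => f l x) Q = 0) : Q = 0 := by
  set Q' : MvPolynomial κ L := aeval (fun l => X l + C (f₀ l)) Q with hQ'
  have heval : ∀ y, eval y Q' = eval (fun l => y l + f₀ l) Q := by
    intro y
    rw [hQ', aeval_def, hom_eval₂]
    have : (eval y).comp (algebraMap L (MvPolynomial κ L)) = RingHom.id L := by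
      ext; simp [algebraMap_eq]
    rw [this, eval₂_id]
    simp
  suffices hzero : Q' = 0 by
    refine funext fun y => ?_
    have := heval fun l => y l - f₀ l
    simpa [hzero] using this.symm
  by_contra hne
  have hex : ∃ k, homogeneousComponent k Q' ≠ 0 := by
    by_contra! h
    exact hne (by rw [← sum_homogeneousComponent Q']; simp [h])
  classical
  let k := Nat.find hex
  have hmin : ∀ m < k, homogeneousComponent m Q' = 0 := fun m hm => by
    simpa using Nat.find_min hex hm
  refine Nat.find_spec hex (funext fun y => ?_)
  obtain ⟨δ, hδ⟩ := hsurj y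
  have hR : aeval (fun l => (Polynomial.X : Polynomial L) * v δ l) Q' = 0 := by
    refine Polynomial.funext fun ε => ?_
    rw [Polynomial.eval_zero, ← Polynomial.coe_evalRingHom, aeval_def, hom_eval₂]
    have : (Polynomial.evalRingHom ε).comp (algebraMap L (Polynomial L)) = RingHom.id L := by
      ext; simp
    rw [this, eval₂_id, heval, ← hQ (line δ ε)]
    refine congrArg (fun g => eval g Q) (_root_.funext fun l => ?_)
    simp [hf, add_comm]
  rw [← sum_homogeneousComponent Q', map_sum] at hR
  simp only [aeval_mul_of_isHomogeneous (homogeneousComponent_isHomogeneous _ Q')] at hR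
  have hk : (Polynomial.X : Polynomial L) ^ (k + 1) ∣
      Polynomial.X ^ k * aeval (v δ) (homogeneousComponent k Q') := by
    by_cases hkd : k < Q'.totalDegree + 1
    · rw [← Finset.add_sum_erase _ _ (Finset.mem_range.2 hkd), add_eq_zero_iff_eq_neg] at hR
      rw [hR, dvd_neg]
      refine Finset.dvd_sum fun m hm => ?_
      rcases lt_or_gt_of_ne (Finset.ne_of_mem_erase hm) with h | h
      · simp [hmin m h]
      · exact (pow_dvd_pow _ h).mul_right _
    · rw [homogeneousComponent_eq_zero k Q' (by omega)]
      simp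
  rw [pow_succ, mul_dvd_mul_iff_left (pow_ne_zero _ Polynomial.X_ne_zero),
    Polynomial.X_dvd_iff, Polynomial.coeff_zero_eq_eval_zero, ← Polynomial.coe_evalRingHom,
    aeval_def, hom_eval₂] at hk
  have : (Polynomial.evalRingHom 0).comp (algebraMap L (Polynomial L)) = RingHom.id L := by
    ext; simp
  rw [this, eval₂_id] at hk
  have hy : (Polynomial.evalRingHom 0 ∘ fun l => v δ l) = y := by
    ext l; exact hδ l
  rw [map_zero, ← hy]
  exact hk

end algebraicIndependence

/-- Bound for the degree of an algebraic relation between `N + 1` polynomials of degree at most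
`b` in `N` variables. -/
def relationBound (N b : ℕ) : ℕ := ((N + 1) * b + 1) ^ N + 1

theorem relationBound_spec (N b : ℕ) :
    ((N + 1) * b * relationBound N b + 1) ^ N < relationBound N b ^ (N + 1) := by
  set B := relationBound N b with hB
  have hB1 : 1 ≤ B := by simp [hB, relationBound]
  calc ((N + 1) * b * B + 1) ^ N ≤ (((N + 1) * b + 1) * B) ^ N :=
        Nat.pow_le_pow_left (by rw [add_mul _ 1 B]; omega) N
    _ = ((N + 1) * b + 1) ^ N * B ^ N := mul_pow _ _ _
    _ < B * B ^ N := Nat.mul_lt_mul_of_pos_right (by simp [hB, relationBound]) (by positivity)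
    _ = B ^ (N + 1) := by rw [pow_succ, mul_comm]

namespace PolyDeg

variable {ι κ L : Type*} [Field L]

theorem exists_matrix_mul_ne_zero [Infinite L] {d e : ℕ} {F G : Matrix ι ι L → L}
    (hF : PolyDeg d F) (hG : PolyDeg e G) (hF0 : ∃ x, F x ≠ 0) (hG0 : ∃ x, G x ≠ 0) :
    ∃ x, F x * G x ≠ 0 := by
  obtain ⟨p, -, hF⟩ := hF
  obtain ⟨q, -, hG⟩ := hG
  obtain ⟨x, hx⟩ := hF0
  obtain ⟨y, hy⟩ := hG0
  by_contra! h
  have : p * q = 0 := MvPolynomial.funext fun z => by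
    have := h (Matrix.of fun a b => z (a, b))
    rw [hF, hG] at this
    simpa using this
  rcases mul_eq_zero.1 this with rfl | rfl
  · exact hx (by simp [hF])
  · exact hy (by simp [hG])

variable [Fintype ι] [Fintype κ]

theorem exists_relation {b N : ℕ} {f : κ → Matrix ι ι L → L} (hf : ∀ l, PolyDeg b (f l))
    {u : Matrix ι ι L → L} (hu : PolyDeg b u) (hN : Fintype.card ι * Fintype.card ι = N)
    (hκ : Fintype.card κ = N) :
    ∃ r : Fin (relationBound N b) → MvPolynomial κ L,
      (∀ k, (r k).totalDegree ≤ N * relationBound N b) ∧ (∃ k, r k ≠ 0) ∧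
      ∀ x, ∑ k, MvPolynomial.eval (fun l => f l x) (r k) * u x ^ (k : ℕ) = 0 := by
  classical
  set B := relationBound N b with hB
  obtain ⟨V, hfin, hV, hmem⟩ := exists_submodule (Matrix ι ι L) (fun x => x) ((N + 1) * b * B)
  rw [hN] at hV
  have hmon : ∀ m : (κ → Fin B) × Fin B,
      (fun x => (∏ l, f l x ^ (m.1 l : ℕ)) * u x ^ (m.2 : ℕ)) ∈ V := by
    intro m
    refine (hmem _).2 ⟨_, ?_, rfl⟩
    refine ((prod Finset.univ (δ := fun l => (m.1 l : ℕ) * b) fun l _ => (hf l).pow _).mul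
      (hu.pow m.2)).mono ?_
    calc ∑ l, (m.1 l : ℕ) * b + m.2 * b ≤ ∑ _l : κ, B * b + B * b :=
          add_le_add (Finset.sum_le_sum fun l _ => Nat.mul_le_mul_right _ (m.1 l).2.le)
            (Nat.mul_le_mul_right _ m.2.2.le)
      _ = (N + 1) * b * B := by
        rw [Finset.sum_const, Finset.card_univ, hκ, smul_eq_mul]; ring
  have hdep : ¬ LinearIndependent L fun m : (κ → Fin B) × Fin B =>
      (⟨_, hmon m⟩ : V) := by
    intro h
    have := h.fintype_card_le_finrank.trans hV
    simp only [Fintype.card_prod, Fintype.card_fun, Fintype.card_fin, hκ] at this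
    rw [← pow_succ] at this
    exact absurd this (not_le.2 (relationBound_spec N b))
  obtain ⟨g, hg, m₀, hm₀⟩ := Fintype.not_linearIndependent_iff.1 hdep
  let E : (κ → Fin B) → (κ →₀ ℕ) := fun m => Finsupp.equivFunOnFinite.symm fun l => (m l : ℕ)
  have hE : Function.Injective E := fun m m' h => by
    ext l
    exact DFunLike.congr_fun h l
  refine ⟨fun k => ∑ m, MvPolynomial.monomial (E m) (g (m, k)), fun k => ?_, ⟨m₀.2, ?_⟩,
    fun x => ?_⟩
  · refine MvPolynomial.totalDegree_finsetSum_le fun m _ => ?_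
    refine (MvPolynomial.totalDegree_monomial_le _ _).trans ?_
    rw [Finsupp.sum_fintype _ _ fun _ => rfl]
    calc ∑ l, E m l ≤ ∑ _l : κ, B := Finset.sum_le_sum fun l _ => (m l).2.le
      _ = N * B := by rw [Finset.sum_const, Finset.card_univ, hκ, smul_eq_mul]
  · intro h
    have := congrArg (MvPolynomial.coeff (E m₀.1)) h
    rw [MvPolynomial.coeff_sum, Finset.sum_eq_single m₀.1] at this
    · simp only [MvPolynomial.coeff_monomial, if_true, MvPolynomial.coeff_zero] at this
      exact hm₀ this
    · intro m _ hm
      rw [MvPolynomial.coeff_monomial, if_neg fun h => hm (hE h)]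
    · simp
  · have := congrArg (fun F : V => F.1 x) hg
    simp only [Submodule.coe_sum, Submodule.coe_smul, Finset.sum_apply, Pi.smul_apply,
      smul_eq_mul, ZeroMemClass.coe_zero, Pi.zero_apply, Fintype.sum_prod_type_right] at this
    rw [← this]
    refine Finset.sum_congr rfl fun k _ => ?_
    rw [map_sum, Finset.sum_mul]
    refine Finset.sum_congr rfl fun m _ => ?_
    rw [MvPolynomial.eval_monomial, Finsupp.prod_fintype _ _ fun _ => pow_zero _, mul_assoc]
    rfl

/-- Given as many algebraically independent functions as there are matrix entries, every entry is,
after rescaling and generically on `SL`, a root of a polynomial of bounded degree determined by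
the values of these functions. -/
theorem exists_entry_mem_roots [DecidableEq ι] [Nonempty ι] [IsAlgClosed L] {b N : ℕ}
    (hb : 1 ≤ b) {f : κ → Matrix ι ι L → L} (hf : ∀ l, PolyDeg b (f l))
    (hN : Fintype.card ι * Fintype.card ι = N) (hκ : Fintype.card κ = N)
    (hind : ∀ Q : MvPolynomial κ L, (∀ x, MvPolynomial.eval (fun l => f l x) Q = 0) → Q = 0)
    (q : ι × ι) :
    ∃ (c : L) (S : Matrix ι ι L → L), PolyDeg (N * relationBound N b * b) S ∧
      (∃ x : Matrix.SpecialLinearGroup ι L, S x ≠ 0) ∧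
      ∀ y : κ → L, ∃ Z : Finset L, Z.card ≤ relationBound N b ∧
        ∀ x : Matrix ι ι L, S x ≠ 0 → (∀ l, f l (c • x) = y l) → x q.1 q.2 ∈ Z := by
  classical
  have : Infinite L := IsAlgClosed.instInfinite
  obtain ⟨r, hdeg, ⟨k, hk⟩, hr⟩ :=
    exists_relation hf ((entry q.1 q.2 : PolyDeg 1 _).mono hb) hN hκ
  have hx₀ : ∃ x, MvPolynomial.eval (fun l => f l x) (r k) ≠ 0 := by
    by_contra! h
    exact hk (hind _ h)
  obtain ⟨x₀, hx₀⟩ := exists_matrix_mul_ne_zero (eval (r k) hf (hdeg k))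
    (det (M := fun x => x) (entry · ·)) hx₀ ⟨1, by simp⟩
  have hn : 0 < Fintype.card ι := Fintype.card_pos
  obtain ⟨c, hc⟩ := IsAlgClosed.exists_pow_nat_eq x₀.det hn
  have hc0 : c ≠ 0 := by
    rintro rfl
    rw [zero_pow hn.ne'] at hc
    exact hx₀ (by rw [← hc, mul_zero])
  refine ⟨c, fun x => MvPolynomial.eval (fun l => f l (c • x)) (r k), ?_,
    ⟨⟨c⁻¹ • x₀, ?_⟩, ?_⟩, fun y => ?_⟩
  · refine eval (F := fun l x => f l (c • x)) (r k) (fun l => ?_) (hdeg k)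
    simpa using (hf l).comp (M := fun x => c • x) fun a b => (entry a b).const_mul c
  · rw [Matrix.det_smul, ← hc, ← mul_pow, inv_mul_cancel₀ hc0, one_pow]
  · simp only [smul_smul, mul_inv_cancel₀ hc0, one_smul]
    exact left_ne_zero_of_mul hx₀
  · set p : Polynomial L := ∑ j : Fin (relationBound N b),
      Polynomial.C (MvPolynomial.eval y (r j)) * Polynomial.X ^ (j : ℕ) with hp
    refine ⟨p.roots.toFinset.image (c⁻¹ * ·), ?_, fun x hx hxy => ?_⟩
    · refine Finset.card_image_le.trans ((Multiset.toFinset_card_le _).trans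
        ((Polynomial.card_roots' p).trans ?_))
      refine Polynomial.natDegree_sum_le_of_forall_le _ _ fun j _ => ?_
      exact (Polynomial.natDegree_C_mul_X_pow_le _ _).trans j.2.le
    · have hy : (fun l => f l (c • x)) = y := funext hxy
      have hp0 : p ≠ 0 := by
        intro h
        have := congrArg (fun p => Polynomial.coeff p k) h
        simp only [hp, Polynomial.finsetSum_coeff, Polynomial.coeff_C_mul, Polynomial.coeff_X_pow,
          Polynomial.coeff_zero, Fin.val_inj, mul_ite, mul_one, mul_zero,
          Finset.sum_ite_eq, Finset.mem_univ, if_true] at this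
        exact hx (by rw [← hy] at this; exact this)
      refine Finset.mem_image.2 ⟨c * x q.1 q.2, ?_, by rw [inv_mul_cancel_left₀ hc0]⟩
      rw [Multiset.mem_toFinset, Polynomial.mem_roots hp0, Polynomial.IsRoot.def, hp,
        Polynomial.eval_finsetSum]
      have := hr (c • x)
      rw [hy] at this
      simpa using this

end PolyDeg

/-- A map whose fibers on a finite set have at most `D` elements. -/
theorem ncard_le_mul_ncard_image {Y Z : Type*} {S : Set Y} (hS : S.Finite) (f : Y → Z) (D : ℕ)
    (h : ∀ y ∈ S, {x ∈ S | f x = f y}.ncard ≤ D) : S.ncard ≤ D * (f '' S).ncard := by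
  classical
  lift S to Finset Y using hS
  rw [← Finset.coe_image, Set.ncard_coe_finset, Set.ncard_coe_finset]
  refine Finset.card_le_mul_card_image S D fun z hz => ?_
  obtain ⟨y, hy, rfl⟩ := Finset.mem_image.1 hz
  have := h y hy
  rw [← Set.ncard_coe_finset]
  simpa using this

section jacobian

open Polynomial

variable {ι : Type*} [Fintype ι] [DecidableEq ι]

/-- Jacobi's formula for the derivative of the determinant along a line. -/
theorem coeff_one_det_add_X_smul {R : Type*} [CommRing R] [IsDomain R] (P Q : Matrix ι ι R)
    (hP : P.det ≠ 0) :
    (P.map C + (X : R[X]) • Q.map C).det.coeff 1 = (P.adjugate * Q).trace := by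
  refine mul_right_cancel₀ hP ?_
  have h1 : (P.map C + (X : R[X]) • Q.map C).det.comp (C P.det * X) =
      C P.det * (1 + (X : R[X]) • (P.adjugate * Q).map C).det := by
    have h2 : C P.det = (P.map (C : R →+* R[X])).det := (C : R →+* R[X]).map_det P
    have h3 : P.map (C : R →+* R[X]) * P.adjugate.map (C : R →+* R[X]) =
        C P.det • (1 : Matrix ι ι R[X]) := by
      rw [← Matrix.map_mul, Matrix.mul_adjugate]
      ext a b
      simp [Matrix.one_apply, apply_ite]
    rw [← coe_compRingHom_apply, RingHom.map_det]
    conv_rhs => rw [h2]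
    rw [← Matrix.det_mul, mul_add, mul_one, Matrix.mul_smul, Matrix.map_mul, ← mul_assoc, h3]
    congr 1
    ext a b : 1
    simp only [RingHom.mapMatrix_apply, Matrix.smul_mul, one_mul, Matrix.map_apply,
      Matrix.add_apply, Matrix.smul_apply, smul_eq_mul, coe_compRingHom_apply, add_comp, mul_comp,
      X_comp, C_comp]
    ring
  have h2 := congrArg (fun p => Polynomial.coeff p 1) h1
  simp only [comp_C_mul_X_coeff, coeff_C_mul, pow_one] at h2
  rw [h2, mul_comm, Matrix.coeff_det_one_add_X_smul_one]

theorem exists_eval_eq_coeff_eval_C {R : Type*} [CommRing R] (U : R[X][X]) (k : ℕ) :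
    ∃ v : R[X], ∀ ε, v.eval ε = (U.eval (C ε)).coeff k := by
  induction U using Polynomial.induction_on' with
  | add p q hp hq =>
    obtain ⟨v, hv⟩ := hp
    obtain ⟨w, hw⟩ := hq
    exact ⟨v + w, by simp [hv, hw]⟩
  | monomial i a =>
    refine ⟨C (a.coeff k) * X ^ i, fun ε => ?_⟩
    rw [eval_monomial, ← C_pow, coeff_mul_C]
    simp

variable {L : Type*} [Field L]

theorem exists_charpoly_expansion (Z D : Matrix ι ι L) (k : ℕ) :
    ∃ v : L[X], (∀ ε, (Z + ε • D).charpoly.coeff k = Z.charpoly.coeff k + ε * v.eval ε) ∧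
      v.eval 0 = -(Z.charmatrix.adjugate * D.map C).trace.coeff k := by
  set W := (Z.charmatrix.map C + (X : L[X][X]) • (-D.map C : Matrix ι ι L[X]).map C).det with hW
  have hWeval : ∀ ε, W.eval (C ε) = (Z + ε • D).charpoly := by
    intro ε
    rw [hW, ← coe_evalRingHom, RingHom.map_det, Matrix.charpoly]
    congr 1
    ext a b : 1
    simp [Matrix.charmatrix_apply]
    ring
  obtain ⟨v, hv⟩ := exists_eval_eq_coeff_eval_C W.divX k
  refine ⟨v, fun ε => ?_, ?_⟩
  · have h0 : W.coeff 0 = Z.charpoly := by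
      rw [coeff_zero_eq_eval_zero, ← C_0, hWeval, zero_smul, add_zero]
    rw [← hWeval, ← divX_mul_X_add W, hv, h0]
    simp [mul_comm, add_comm]
  · rw [hv, C_0, ← coeff_zero_eq_eval_zero, coeff_divX, zero_add, hW,
      coeff_one_det_add_X_smul _ _ (Matrix.charpoly_monic Z).ne_zero, mul_neg, Matrix.trace_neg,
      coeff_neg]

theorem coeff_trace_adjugate_charmatrix_succ (Z B : Matrix ι ι L) (k : ℕ) :
    (Z.charmatrix.adjugate * B.map C).trace.coeff k =
      (Z.charmatrix.adjugate * (Z * B).map C).trace.coeff (k + 1) +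
        Z.charpoly.coeff (k + 1) * B.trace := by
  have h : X * (Z.charmatrix.adjugate * B.map C).trace =
      (Z.charmatrix.adjugate * (Z * B).map C).trace + Z.charpoly * C B.trace := by
    have h1 : Z.charmatrix.adjugate * (Z.charmatrix * B.map C) = Z.charpoly • B.map C := by
      rw [← mul_assoc, Matrix.adjugate_mul, Matrix.charpoly, Matrix.smul_mul, one_mul]
    have h2 : Z.charmatrix * B.map C = (X : L[X]) • B.map C - (Z * B).map C := by
      rw [Matrix.charmatrix, sub_mul, Matrix.map_mul]
      congr 1
      ext a b : 1
      simp
    have h3 := congrArg Matrix.trace h1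
    rw [h2, mul_sub, Matrix.trace_sub, Matrix.mul_smul, Matrix.trace_smul, Matrix.trace_smul,
      smul_eq_mul, smul_eq_mul, sub_eq_iff_eq_add'] at h3
    rw [h3]
    congr 2
    exact (AddMonoidHom.map_trace (C : L →+* L[X]).toAddMonoidHom B).symm
  have := congrArg (fun p => coeff p (k + 1)) h
  simpa using this

theorem coeff_trace_adjugate_charmatrix_eq_zero (Z B : Matrix ι ι L) {k : ℕ}
    (hk : Fintype.card ι ≤ k) : (Z.charmatrix.adjugate * B.map C).trace.coeff k = 0 := by
  obtain ⟨N, hN⟩ : ∃ N, ∀ m ≥ N, ∀ B : Matrix ι ι L,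
      (Z.charmatrix.adjugate * B.map C).trace.coeff m = 0 := by
    refine ⟨∑ a, ∑ b, (Z.charmatrix.adjugate a b).natDegree + 1, fun m hm B => ?_⟩
    simp only [Matrix.trace, Matrix.diag, Matrix.mul_apply, finsetSum_coeff, Matrix.map_apply,
      coeff_mul_C]
    refine Finset.sum_eq_zero fun a _ => Finset.sum_eq_zero fun b _ => ?_
    rw [coeff_eq_zero_of_natDegree_lt, zero_mul]
    refine lt_of_le_of_lt ?_ (Nat.lt_of_succ_le hm)
    exact (Finset.single_le_sum (f := fun b => (Z.charmatrix.adjugate a b).natDegree)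
        (fun _ _ => Nat.zero_le _) (Finset.mem_univ b)).trans
      (Finset.single_le_sum (f := fun a => ∑ b, (Z.charmatrix.adjugate a b).natDegree)
        (fun _ _ => Nat.zero_le _) (Finset.mem_univ a))
  have h : ∀ (m : ℕ) (B : Matrix ι ι L) (k : ℕ), Fintype.card ι ≤ k → N ≤ k + m →
      (Z.charmatrix.adjugate * B.map C).trace.coeff k = 0 := by
    intro m
    induction m with
    | zero => exact fun B k _ h => hN k h B
    | succ m ih =>
      intro B k hk h
      rw [coeff_trace_adjugate_charmatrix_succ, ih _ _ (by omega) (by omega),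
        coeff_eq_zero_of_natDegree_lt (by rw [Matrix.charpoly_natDegree_eq_dim]; omega)]
      simp
  exact h N B k hk (by omega)

theorem trace_pow_mul_eq_zero_of_coeff (Z : Matrix ι ι L) (j : ℕ) (hj : j < Fintype.card ι) :
    ∀ B : Matrix ι ι L, (∀ i ≤ j,
      (Z.charmatrix.adjugate * B.map C).trace.coeff (Fintype.card ι - 1 - i) = 0) →
      (Z ^ j * B).trace = 0 := by
  have htop : ∀ B : Matrix ι ι L,
      (Z.charmatrix.adjugate * B.map C).trace.coeff (Fintype.card ι - 1) = B.trace := by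
    intro B
    have hc : Fintype.card ι - 1 + 1 = Fintype.card ι := by omega
    have hm : Z.charpoly.coeff (Fintype.card ι) = 1 := by
      have := (Matrix.charpoly_monic Z).coeff_natDegree
      rwa [Matrix.charpoly_natDegree_eq_dim] at this
    rw [coeff_trace_adjugate_charmatrix_succ, hc, hm,
      coeff_trace_adjugate_charmatrix_eq_zero _ _ le_rfl]
    simp
  induction j with
  | zero =>
    intro B hB
    have := hB 0 le_rfl
    rw [Nat.sub_zero, htop] at this
    simpa using this
  | succ j ih =>
    intro B hB
    rw [pow_succ, mul_assoc]
    refine ih (by omega) _ fun i hi => ?_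
    have h0 := hB 0 (Nat.zero_le _)
    rw [Nat.sub_zero, htop] at h0
    have h1 := hB (i + 1) (by omega)
    rw [coeff_trace_adjugate_charmatrix_succ, h0, mul_zero, add_zero] at h1
    convert h1 using 2
    omega

/-- The determinant and the middle coefficients of the characteristic polynomials of `Y_p x`. -/
noncomputable def charFun {n m : ℕ} (Y : Fin m → Matrix (Fin n) (Fin n) L) :
    Option (Fin m × Fin (n - 1)) → Matrix (Fin n) (Fin n) L → L
  | none, x => x.det
  | some (p, j), x => (Y p * x).charpoly.coeff (n - 1 - j)

theorem polyDeg_charFun {n m : ℕ} (Y : Fin m → Matrix (Fin n) (Fin n) L)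
    (l : Option (Fin m × Fin (n - 1))) : PolyDeg n (charFun Y l) := by
  match l with
  | none =>
    have h := PolyDeg.det (M := fun x : Matrix (Fin n) (Fin n) L => x) fun a b => PolyDeg.entry a b
    simp only [Fintype.card_fin, mul_one] at h
    exact h
  | some (p, j) =>
    have h := (PolyDeg.charpoly_coeff (ι := Fin n) (L := L) (n - 1 - j)).comp
      (PolyDeg.matrix_const_mul (Y p) fun a b => PolyDeg.entry a b)
    simp only [Fintype.card_fin, mul_one] at h
    exact h

/-- Jacobian criterion for the algebraic independence of the functions `charFun Y`. -/
theorem charFun_independent [Infinite L] {n m : ℕ} (hcard : m * (n - 1) + 1 = n * n)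
    (Y : Fin m → Matrix (Fin n) (Fin n) L) (g : Matrix (Fin n) (Fin n) L) (hg : g.det = 1)
    (hnd : ∀ δ : Matrix (Fin n) (Fin n) L, δ.trace = 0 →
      (∀ p, ∀ j < n - 1, ((Y p * g) ^ (j + 1) * δ).trace = 0) → δ = 0)
    (Q : MvPolynomial (Option (Fin m × Fin (n - 1))) L)
    (hQ : ∀ x, MvPolynomial.eval (fun l => charFun Y l x) Q = 0) : Q = 0 := by
  have hexp : ∀ (δ : Matrix (Fin n) (Fin n) L) (l : Option (Fin m × Fin (n - 1))), ∃ v : L[X],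
      (∀ ε, charFun Y l (g + ε • (g * δ)) = charFun Y l g + ε * v.eval ε) ∧
      v.eval 0 = l.elim δ.trace fun q =>
        -((Y q.1 * g).charmatrix.adjugate * (Y q.1 * g * δ).map C).trace.coeff (n - 1 - q.2) := by
    intro δ l
    match l with
    | none =>
      set W := (1 + (X : L[X]) • δ.map C).det with hW
      refine ⟨W.divX, fun ε => ?_, ?_⟩
      · have h1 : (1 + ε • δ).det = W.eval ε := by
          rw [hW, ← coe_evalRingHom, RingHom.map_det]
          congr 1
          ext a b : 1
          simp only [RingHom.mapMatrix_apply, Matrix.map_apply, Matrix.add_apply,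
            Matrix.smul_apply, Matrix.one_apply, smul_eq_mul, coe_evalRingHom, eval_add, eval_mul,
            eval_X, eval_C, apply_ite (eval ε), eval_one, eval_zero]
        have h2 : W.coeff 0 = 1 := by
          rw [coeff_zero_eq_eval_zero, hW, ← coe_evalRingHom, RingHom.map_det]
          have : (evalRingHom (0 : L)).mapMatrix (1 + (X : L[X]) • δ.map C) = 1 := by
            ext a b : 1
            simp [Matrix.one_apply, apply_ite]
          rw [this, Matrix.det_one]
        have h3 : g + ε • (g * δ) = g * (1 + ε • δ) := by
          rw [mul_add, mul_one, Matrix.mul_smul]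
        simp only [charFun]
        rw [h3, Matrix.det_mul, hg, one_mul, h1]
        conv_lhs => rw [← divX_mul_X_add W, h2]
        simp [mul_comm, add_comm]
      · rw [← coeff_zero_eq_eval_zero, coeff_divX, zero_add, hW,
          Matrix.coeff_det_one_add_X_smul_one]
        rfl
    | some (p, j) =>
      obtain ⟨v, hv, hv0⟩ := exists_charpoly_expansion (Y p * g) (Y p * g * δ) (n - 1 - j)
      refine ⟨v, fun ε => ?_, hv0⟩
      rw [charFun, charFun, ← hv, mul_add, Matrix.mul_smul, mul_assoc]
  choose v hv hv0 using hexp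
  let Λ : Matrix (Fin n) (Fin n) L →ₗ[L] (Option (Fin m × Fin (n - 1)) → L) :=
    { toFun := fun δ l => l.elim δ.trace fun q =>
        -((Y q.1 * g).charmatrix.adjugate * (Y q.1 * g * δ).map C).trace.coeff (n - 1 - q.2)
      map_add' := by
        intro δ δ'
        ext l
        match l with
        | none => simp
        | some q =>
          simp only [Option.elim_some, Pi.add_apply, mul_add, Matrix.map_add C (map_add C),
            Matrix.trace_add, coeff_add]
          ring
      map_smul' := by
        intro c δ
        ext l
        match l with
        | none => simp
        | some q =>
          have : (c • (Y q.1 * g * δ)).map (C : L →+* L[X]) =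
              (C c) • (Y q.1 * g * δ).map (C : L →+* L[X]) := by
            ext a b : 1
            simp only [Matrix.map_apply, Matrix.smul_apply, smul_eq_mul, C_mul]
          simp [this] }
  have hinj : Function.Injective Λ := by
    rw [injective_iff_map_eq_zero]
    intro δ hδ
    refine hnd δ (congrFun hδ none) fun p j hj => ?_
    rw [pow_succ, mul_assoc]
    refine trace_pow_mul_eq_zero_of_coeff _ j (by simp; omega) _ fun i hi => ?_
    have := congrFun hδ (some (p, ⟨i, by omega⟩))
    simpa [Λ] using this
  have hsurj : Function.Surjective Λ :=
    (LinearMap.injective_iff_surjective_of_finrank_eq_finrank (by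
      simp [Module.finrank_matrix, hcard])).1 hinj
  refine eq_zero_of_eval_eq_zero_of_surjective (charFun Y) (fun δ ε => g + ε • (g * δ))
    (fun l => charFun Y l g) v (fun δ l ε => hv δ l ε) (fun y => ?_) Q hQ
  obtain ⟨δ, hδ⟩ := hsurj y
  exact ⟨δ, fun l => by rw [hv0, ← hδ]; rfl⟩

end jacobian

section cyclic

open Polynomial
open scoped Fin.CommRing

theorem coeff_prod_X_sub_C_X_pow {L κ : Type*} [Field L] [DecidableEq κ] (N : κ → ℕ)
    (hN : Function.Injective N) (s : Finset κ) :
    (∀ i ≤ s.card, (∏ a ∈ s, (X - C ((X : L[X]) ^ N a))).coeff i ≠ 0) ∧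
    ∀ i < s.card, ∀ b, (∀ a ∈ s, b < N a) →
      ((∏ a ∈ s, (X - C ((X : L[X]) ^ N a))).coeff (i + 1)).natDegree + b <
        ((∏ a ∈ s, (X - C ((X : L[X]) ^ N a))).coeff i).natDegree := by
  induction s using Finset.induction_on_min_value N with
  | empty => simp
  | insert a s ha hmin ih =>
    obtain ⟨ih0, ih1⟩ := ih
    have hlt : ∀ x ∈ s, N a < N x := fun x hx =>
      lt_of_le_of_ne (hmin x hx) fun h => ha (hN h ▸ hx)
    rw [Finset.prod_insert ha, Finset.card_insert_of_notMem ha]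
    set Q := ∏ a ∈ s, (X - C ((X : L[X]) ^ N a)) with hQ
    have hdeg : Q.natDegree = s.card := by
      rw [hQ, natDegree_prod_of_monic _ _ fun a _ => monic_X_sub_C _]
      simp only [natDegree_X_sub_C, Finset.sum_const, smul_eq_mul, mul_one]
    have hc0 : ((X - C ((X : L[X]) ^ N a)) * Q).coeff 0 = -(X ^ N a * Q.coeff 0) := by
      rw [sub_mul, coeff_sub, coeff_X_mul_zero, coeff_C_mul, zero_sub]
    have hc : ∀ i, ((X - C ((X : L[X]) ^ N a)) * Q).coeff (i + 1) =
        Q.coeff i - X ^ N a * Q.coeff (i + 1) := fun i => by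
      rw [sub_mul, coeff_sub, coeff_X_mul, coeff_C_mul]
    have hd0 : (((X - C ((X : L[X]) ^ N a)) * Q).coeff 0).natDegree =
        N a + (Q.coeff 0).natDegree := by
      rw [hc0, natDegree_neg, natDegree_mul (by simp) (ih0 0 (Nat.zero_le _)), natDegree_X_pow]
    have hd : ∀ i ≤ s.card, ((X - C ((X : L[X]) ^ N a)) * Q).coeff (i + 1) ≠ 0 ∧
        (((X - C ((X : L[X]) ^ N a)) * Q).coeff (i + 1)).natDegree = (Q.coeff i).natDegree := by
      intro i hi
      rw [hc]
      rcases hi.lt_or_eq with hi | rfl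
      · have h1 : (X ^ N a * Q.coeff (i + 1)).natDegree < (Q.coeff i).natDegree := by
          rw [natDegree_mul (by simp) (ih0 _ hi), natDegree_X_pow, add_comm]
          exact ih1 i hi _ hlt
        have h2 := natDegree_sub_eq_left_of_natDegree_lt h1
        refine ⟨fun h => ?_, h2⟩
        rw [h, natDegree_zero] at h2
        omega
      · rw [coeff_eq_zero_of_natDegree_lt (n := s.card + 1) (by omega), mul_zero, sub_zero]
        exact ⟨ih0 _ le_rfl, rfl⟩
    refine ⟨fun i hi => ?_, fun i hi b hb => ?_⟩
    · cases i with
      | zero =>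
        rw [hc0]
        exact neg_ne_zero.2 (mul_ne_zero (by simp) (ih0 0 (Nat.zero_le _)))
      | succ i => exact (hd i (by omega)).1
    · have hba := hb a (Finset.mem_insert_self _ _)
      rw [(hd i (by omega)).2]
      cases i with
      | zero =>
        rw [hd0]
        omega
      | succ i =>
        rw [(hd i (by omega)).2]
        exact ih1 i (by omega) b fun x hx => hba.trans (hlt x hx)

theorem exists_polynomial_injective_coeff {L : Type*} [Field L] {n i : ℕ} (hi : i ≤ n)
    (N : Fin n → ℕ) (hN : Function.Injective N) :
    ∃ p : L[X], p ≠ 0 ∧ ∀ s, p.eval s ≠ 0 → Function.Injective (fun a => s ^ N a) ∧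
      (∏ a, (X - C (s ^ N a))).coeff i ≠ 0 := by
  refine ⟨(∏ q : Fin n × Fin n, if q.1 = q.2 then 1 else X ^ N q.1 - X ^ N q.2) *
    (∏ a, (X - C ((X : L[X]) ^ N a))).coeff i, ?_, fun s hs => ?_⟩
  · refine mul_ne_zero (Finset.prod_ne_zero_iff.2 fun q _ => ?_)
      ((coeff_prod_X_sub_C_X_pow N hN _).1 i (by simpa using hi))
    split_ifs with h
    · exact one_ne_zero
    · intro h0
      have := congrArg natDegree (sub_eq_zero.1 h0)
      rw [natDegree_X_pow, natDegree_X_pow] at this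
      exact h (hN this)
  · rw [eval_mul, eval_prod] at hs
    refine ⟨fun a b hab => ?_, ?_⟩
    · by_contra hne
      refine Finset.prod_ne_zero_iff.1 (left_ne_zero_of_mul hs) (a, b) (Finset.mem_univ _) ?_
      simpa [hne, sub_eq_zero] using hab
    · have h := right_ne_zero_of_mul hs
      rw [← coe_evalRingHom, ← coeff_map, Polynomial.map_prod] at h
      simpa using h

theorem eq_zero_of_sum_pow_mul_eq_zero {L : Type*} [Field L] {n i : ℕ} (u w : Fin n → L)
    (hu : Function.Injective u) (hc : (∏ a, (X - C (u a))).coeff i ≠ 0)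
    (h : ∀ m ≤ n, m ≠ i → ∑ a, u a ^ m * w a = 0) : w = 0 := by
  have hsum : ∀ p : L[X], p.natDegree ≤ n → ∑ a, p.eval (u a) * w a =
      p.coeff i * ∑ a, u a ^ i * w a := by
    intro p hp
    simp_rw [eval_eq_sum_range' (Nat.lt_succ_of_le hp), Finset.sum_mul]
    rw [Finset.sum_comm]
    simp_rw [mul_assoc, ← Finset.mul_sum]
    by_cases hi : i ≤ n
    · rw [Finset.sum_eq_single_of_mem i (by simp; omega)]
      intro m hm hne
      rw [h m (by simp at hm; omega) hne, mul_zero]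
    · rw [coeff_eq_zero_of_natDegree_lt (by omega), zero_mul]
      exact Finset.sum_eq_zero fun m hm => by
        rw [h m (by simp at hm; omega) (by simp at hm; omega), mul_zero]
  have hi : ∑ a, u a ^ i * w a = 0 := by
    have h1 := hsum (∏ a, (X - C (u a))) (by
      rw [natDegree_prod_of_monic _ _ fun a _ => monic_X_sub_C _]; simp)
    rw [Finset.sum_eq_zero fun a _ => by
      rw [eval_prod, Finset.prod_eq_zero (Finset.mem_univ a) (by simp), zero_mul]] at h1
    exact (mul_eq_zero.1 h1.symm).resolve_left hc
  refine Matrix.eq_zero_of_forall_pow_sum_mul_pow_eq_zero hu fun m => ?_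
  rw [← (by simp [mul_comm] : ∑ a, u a ^ (m : ℕ) * w a = ∑ a, w a * u a ^ (m : ℕ))]
  by_cases hm : (m : ℕ) = i
  · rw [hm, hi]
  · exact h m m.2.le hm

/-- The weighted cyclic shift matrix. -/
def cyclicMatrix {L : Type*} [Zero L] {n : ℕ} [NeZero n] (u : Fin n → L) :
    Matrix (Fin n) (Fin n) L :=
  Matrix.of fun a b => if b = a + 1 then u a else 0

theorem cyclicMatrix_pow {L : Type*} [CommRing L] {n : ℕ} [NeZero n] (u : Fin n → L) (j : ℕ)
    (a b : Fin n) : (cyclicMatrix u ^ j) a b =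
      if b = a + (j : Fin n) then ∏ l ∈ Finset.range j, u (a + (l : Fin n)) else 0 := by
  induction j generalizing a with
  | zero => simp [Matrix.one_apply, eq_comm]
  | succ j ih =>
    rw [pow_succ', Matrix.mul_apply, Finset.sum_eq_single (a + 1)]
    · rw [ih, Finset.prod_range_succ', cyclicMatrix]
      have h : ∀ l : ℕ, a + 1 + (l : Fin n) = a + (l + 1) := fun l => by ring
      simp [mul_comm, h]
    · intro c _ hc
      simp [cyclicMatrix, hc]
    · simp

theorem sum_two_pow_add_injective {n j : ℕ} [NeZero n] (h0 : 0 < j) (hj : j < n) :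
    Function.Injective fun a : Fin n => ∑ l ∈ Finset.range j, 2 ^ (a + (l : Fin n)).val := by
  have hinj : ∀ l < n, ∀ l' < n, (l : Fin n) = (l' : Fin n) → l = l' := by
    intro l hl l' hl' h
    have := congrArg Fin.val h
    rwa [Fin.val_natCast, Fin.val_natCast, Nat.mod_eq_of_lt hl, Nat.mod_eq_of_lt hl'] at this
  have hsum : ∀ a : Fin n, ∑ l ∈ Finset.range j, 2 ^ (a + (l : Fin n)).val =
      ∑ i ∈ (Finset.range j).image fun l : ℕ => (a + (l : Fin n)).val, 2 ^ i := by
    intro a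
    rw [Finset.sum_image]
    intro l hl l' hl' h
    simp only [Finset.coe_range, Set.mem_Iio] at hl hl'
    exact hinj l (by omega) l' (by omega) (add_left_cancel (Fin.val_injective h))
  intro a b hab
  simp only [hsum] at hab
  have himg := Finset.geomSum_injective le_rfl hab
  have hmem : ∀ c : Fin n, (∃ l < j, a + (l : Fin n) = c) ↔ ∃ l < j, b + (l : Fin n) = c := by
    intro c
    have := congrArg (fun s => c.val ∈ s) himg
    simpa [Fin.val_inj] using this
  obtain ⟨l, hl, hbl⟩ := (hmem a).1 ⟨0, h0, by simp⟩
  cases l with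
  | zero => simpa using hbl.symm
  | succ l =>
    obtain ⟨l', hl', h'⟩ := (hmem (b + (l : Fin n))).2 ⟨l, by omega, rfl⟩
    rw [← hbl, Nat.cast_succ] at h'
    have : ((l' + 1 : ℕ) : Fin n) = ((0 : ℕ) : Fin n) := by
      refine add_left_cancel (a := b + (l : Fin n)) ?_
      rw [Nat.cast_zero, add_zero, Nat.cast_succ]
      conv_rhs => rw [← h']
      abel
    have := hinj _ (by omega) _ (by omega) this
    omega

end cyclic

section special

open scoped Fin.CommRing

/-- The matrices whose products with `g` appear in `kappaTuple`. -/
def tupleMatrix {L : Type*} [CommRing L] {n : ℕ} (i : ℕ) (h t : Matrix (Fin n) (Fin n) L)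
    (p : Fin (n + 1)) : Matrix (Fin n) (Fin n) L :=
  if (p : ℕ) = 0 then h else t ^ (if (p : ℕ) - 1 < i then (p : ℕ) - 1 else (p : ℕ))

theorem exists_tupleMatrix_eq_pow {L : Type*} [CommRing L] {n i m : ℕ}
    (h t : Matrix (Fin n) (Fin n) L) (hi : i ≤ n) (hm : m ≤ n) (hmi : m ≠ i) :
    ∃ p : Fin (n + 1), tupleMatrix i h t p = t ^ m := by
  by_cases h : m < i
  · exact ⟨⟨m + 1, by omega⟩, by simp [tupleMatrix, h]⟩
  · exact ⟨⟨m, by omega⟩, by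
      simp [tupleMatrix, show ¬ m - 1 < i by omega, show m ≠ 0 by omega]⟩

theorem det_cyclicMatrix_one_ne_zero {L : Type*} [Field L] {n : ℕ} [NeZero n] :
    (cyclicMatrix (1 : Fin n → L)).det ≠ 0 := by
  have h : cyclicMatrix (1 : Fin n → L) ^ n = 1 := by
    ext a b
    simp [cyclicMatrix_pow, Matrix.one_apply, eq_comm]
  intro h0
  have := congrArg Matrix.det h
  rw [Matrix.det_pow, h0, zero_pow (NeZero.ne n), Matrix.det_one] at this
  exact zero_ne_one this

theorem trace_cyclicMatrix_pow_mul {L : Type*} [CommRing L] {n : ℕ} [NeZero n] (u : Fin n → L)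
    (j : ℕ) (δ : Matrix (Fin n) (Fin n) L) : (cyclicMatrix u ^ j * δ).trace =
      ∑ a, (∏ l ∈ Finset.range j, u (a + (l : Fin n))) * δ (a + (j : Fin n)) a := by
  simp [Matrix.trace, Matrix.mul_apply, cyclicMatrix_pow]

open Polynomial in
theorem exists_cyclic_weights {L : Type*} [Field L] [IsAlgClosed L] {n i : ℕ} [NeZero n]
    (hi : i ≤ n) : ∃ v : Fin n → L, ∏ a, v a = 1 ∧ ∀ j, 0 < j → j < n → ∀ w : Fin n → L,
      (Function.Injective fun a : Fin n => ∏ l ∈ Finset.range j, v (a + (l : Fin n))) ∧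
      ((∀ m ≤ n, m ≠ i → ∑ a, (∏ l ∈ Finset.range j, v (a + (l : Fin n))) ^ m * w a = 0) →
        w = 0) := by
  have hp : ∀ j : ℕ, ∃ p : L[X], p ≠ 0 ∧ (0 < j → j < n → ∀ s, p.eval s ≠ 0 →
      Function.Injective
        (fun a : Fin n => s ^ ∑ l ∈ Finset.range j, 2 ^ (a + (l : Fin n)).val) ∧
      (∏ a : Fin n, (X - C (s ^ ∑ l ∈ Finset.range j, 2 ^ (a + (l : Fin n)).val))).coeff i ≠ 0)
      := by
    intro j
    by_cases hj : 0 < j ∧ j < n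
    · obtain ⟨p, hp, h⟩ := exists_polynomial_injective_coeff (L := L) hi _
        (sum_two_pow_add_injective hj.1 hj.2)
      exact ⟨p, hp, fun _ _ => h⟩
    · exact ⟨1, one_ne_zero, fun h1 h2 => absurd ⟨h1, h2⟩ hj⟩
  choose p hp0 hp using hp
  obtain ⟨s, hs⟩ : ∃ s : L, (X * ∏ j ∈ Finset.range n, p j).eval s ≠ 0 := by
    by_contra! h
    exact mul_ne_zero X_ne_zero (Finset.prod_ne_zero_iff.2 fun j _ => hp0 j)
      (Polynomial.funext fun s => by rw [h s, eval_zero])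
  rw [eval_mul, eval_X, eval_prod] at hs
  have hs0 := left_ne_zero_of_mul hs
  have hsj := Finset.prod_ne_zero_iff.1 (right_ne_zero_of_mul hs)
  have hP : ∏ a : Fin n, s ^ 2 ^ a.val ≠ 0 := Finset.prod_ne_zero_iff.2 fun a _ => pow_ne_zero _ hs0
  obtain ⟨μ, hμ⟩ := IsAlgClosed.exists_pow_nat_eq (∏ a : Fin n, s ^ 2 ^ a.val)⁻¹
    (NeZero.pos n)
  have hμ0 : μ ≠ 0 := by
    rintro rfl
    rw [zero_pow (NeZero.ne n)] at hμ
    exact inv_ne_zero hP hμ.symm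
  have hprod : ∀ (j : ℕ) (a : Fin n), ∏ l ∈ Finset.range j, μ * s ^ 2 ^ (a + (l : Fin n)).val =
      μ ^ j * s ^ ∑ l ∈ Finset.range j, 2 ^ (a + (l : Fin n)).val := by
    intro j a
    rw [Finset.prod_mul_distrib, Finset.prod_const, Finset.card_range, Finset.prod_pow_eq_pow_sum]
  refine ⟨fun a => μ * s ^ 2 ^ a.val, ?_, fun j h0 hj w => ?_⟩
  · rw [Finset.prod_mul_distrib, Finset.prod_const, Finset.card_univ, Fintype.card_fin, hμ,
      inv_mul_cancel₀ hP]
  · obtain ⟨hinj, hcoeff⟩ := hp j h0 hj s (hsj j (by simpa using hj))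
    simp only [hprod]
    refine ⟨fun a b h => hinj (mul_left_cancel₀ (pow_ne_zero j hμ0) h), fun h => ?_⟩
    refine eq_zero_of_sum_pow_mul_eq_zero _ w hinj hcoeff fun m hm hmi => ?_
    have := h m hm hmi
    simp_rw [mul_pow, mul_assoc, ← Finset.mul_sum] at this
    exact (mul_eq_zero.1 this).resolve_left (pow_ne_zero _ (pow_ne_zero _ hμ0))

/-- At `g`, the differentials of the determinant and of the characteristic polynomial coefficients
of all products `Y p * g` jointly separate tangent directions. -/
def IsNondegenerate {L : Type*} [CommRing L] {n m : ℕ} (Y : Fin m → Matrix (Fin n) (Fin n) L)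
    (g : Matrix (Fin n) (Fin n) L) : Prop :=
  ∀ δ : Matrix (Fin n) (Fin n) L, δ.trace = 0 →
    (∀ p, ∀ j < n - 1, ((Y p * g) ^ (j + 1) * δ).trace = 0) → δ = 0

theorem exists_isNondegenerate {L : Type*} [Field L] [IsAlgClosed L] {n i : ℕ} (hn : 2 ≤ n)
    (hi : i ≤ n) : ∃ (v : Fin n → L) (h g : Matrix (Fin n) (Fin n) L), ∏ a, v a = 1 ∧ h.det = 1 ∧
      g.det = 1 ∧ IsNondegenerate (tupleMatrix i h (Matrix.diagonal v)) g := by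
  have : NeZero n := ⟨by omega⟩
  obtain ⟨v, hv, hweights⟩ := exists_cyclic_weights (L := L) hi
  set c := cyclicMatrix (1 : Fin n → L) with hc
  have hc0 : c.det ≠ 0 := det_cyclicMatrix_one_ne_zero
  obtain ⟨ζ, hζ⟩ := IsAlgClosed.exists_pow_nat_eq c.det⁻¹ (NeZero.pos n)
  have hζ0 : ζ ≠ 0 := by
    rintro rfl
    rw [zero_pow (NeZero.ne n)] at hζ
    exact inv_ne_zero hc0 hζ.symm
  have hg : (ζ • c).det = 1 := by
    rw [Matrix.det_smul, Fintype.card_fin, hζ, inv_mul_cancel₀ hc0]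
  have hd : (Matrix.diagonal v).det = 1 := by rw [Matrix.det_diagonal, hv]
  refine ⟨v, Matrix.diagonal v * (ζ • c)⁻¹, ζ • c, hv, ?_, hg, fun δ h0 h => ?_⟩
  · rw [Matrix.det_mul, hd, Matrix.det_nonsing_inv, hg, Ring.inverse_one, mul_one]
  have hmul : ∀ m : ℕ, Matrix.diagonal v ^ m * (ζ • c) =
      ζ • cyclicMatrix fun a => v a ^ m := by
    intro m
    ext a b
    simp [Matrix.diagonal_pow, Matrix.diagonal_mul, hc, cyclicMatrix, mul_comm]
  have hoff : ∀ j, 0 < j → j < n → (fun a : Fin n => δ (a + (j : Fin n)) a) = 0 := by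
    intro j h1 hj
    refine (hweights j h1 hj _).2 fun m hm hmi => ?_
    obtain ⟨p, hp⟩ := exists_tupleMatrix_eq_pow (Matrix.diagonal v * (ζ • c)⁻¹)
      (Matrix.diagonal v) hi hm hmi
    have h2 := h p (j - 1) (by omega)
    rw [hp, hmul, Nat.sub_add_cancel h1, smul_pow, Matrix.smul_mul, Matrix.trace_smul,
      trace_cyclicMatrix_pow_mul] at h2
    simpa [Finset.prod_pow] using (smul_eq_zero.1 h2).resolve_left (pow_ne_zero _ hζ0)
  have hinj : Function.Injective v := by
    have := (hweights 1 one_pos (by omega) 0).1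
    simpa using this
  have hdiag : (fun a => δ a a) = 0 := by
    refine Matrix.eq_zero_of_forall_pow_sum_mul_pow_eq_zero hinj fun m => ?_
    obtain ⟨m, hm⟩ := m
    cases m with
    | zero => simpa [Matrix.trace] using h0
    | succ m =>
      have h2 := h 0 m (by omega)
      rw [tupleMatrix, if_pos (by simp), mul_assoc, Matrix.nonsing_inv_mul _ (by simp [hg]),
        mul_one, Matrix.diagonal_pow] at h2
      simpa [Matrix.trace, Matrix.diagonal_mul, mul_comm] using h2
  ext a b
  by_cases hab : a = b
  · subst hab
    exact congrFun hdiag a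
  · have h1 := congrFun (hoff (a - b).val (by
      rw [Nat.pos_iff_ne_zero, Ne, Fin.val_eq_zero_iff, sub_eq_zero]; exact hab) (a - b).2) b
    simpa using h1

end special

section nondegenerate

variable {L : Type*} [Field L] {n m : ℕ}

/-- The determinant detecting `IsNondegenerate`. -/
def nondegDet (e : Option (Fin m × Fin (n - 1)) ≃ Fin n × Fin n)
    (Y : Fin m → Matrix (Fin n) (Fin n) L) (g : Matrix (Fin n) (Fin n) L) : L :=
  (Matrix.of fun l l' : Option (Fin m × Fin (n - 1)) =>
    (l.elim 1 fun q => (Y q.1 * g) ^ ((q.2 : ℕ) + 1) : Matrix (Fin n) (Fin n) L)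
      (e l').1 (e l').2).det

theorem nondegDet_ne_zero_iff (e : Option (Fin m × Fin (n - 1)) ≃ Fin n × Fin n)
    (Y : Fin m → Matrix (Fin n) (Fin n) L) (g : Matrix (Fin n) (Fin n) L) :
    nondegDet e Y g ≠ 0 ↔ IsNondegenerate Y g := by
  have htr : ∀ (w : Option (Fin m × Fin (n - 1)) → L) (M : Matrix (Fin n) (Fin n) L),
      (M * Matrix.of fun a b => w (e.symm (b, a))).trace =
        ∑ l', M (e l').1 (e l').2 * w l' := by
    intro w M
    rw [← Equiv.sum_comp e.symm, Fintype.sum_prod_type]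
    simp [Matrix.trace, Matrix.mul_apply]
  have hδ : ∀ δ : Matrix (Fin n) (Fin n) L, δ = Matrix.of fun a b =>
      (fun l => δ (e l).2 (e l).1) (e.symm (b, a)) := by
    intro δ
    ext a b
    simp
  rw [nondegDet, Ne, ← Matrix.exists_mulVec_eq_zero_iff, IsNondegenerate]
  constructor
  · intro h δ h0 hδ0
    by_contra hne
    refine h ⟨fun l => δ (e l).2 (e l).1, fun hw => hne ?_, ?_⟩
    · ext a b
      simpa using congrFun hw (e.symm (b, a))
    · ext l
      rw [Matrix.mulVec, dotProduct, Pi.zero_apply]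
      simp only [Matrix.of_apply]
      rw [← htr, ← hδ]
      match l with
      | none => simpa using h0
      | some (p, j) => exact hδ0 p j j.2
  · rintro h ⟨w, hw0, hw⟩
    have h1 := fun l => congrFun hw l
    simp only [Matrix.mulVec, dotProduct, Pi.zero_apply, Matrix.of_apply, ← htr] at h1
    refine hw0 ?_
    have h2 := h (Matrix.of fun a b => w (e.symm (b, a))) (by simpa using h1 none)
      fun p j hj => h1 (some (p, ⟨j, hj⟩))
    ext l
    simpa using congrFun (congrFun h2 (e l).2) (e l).1

theorem polyDeg_nondegDet (e : Option (Fin m × Fin (n - 1)) ≃ Fin n × Fin n)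
    {Y : Matrix (Fin n) (Fin n) L → Fin m → Matrix (Fin n) (Fin n) L} {d : ℕ}
    (hY : ∀ p a b, PolyDeg d fun x => Y x p a b) (g : Matrix (Fin n) (Fin n) L) :
    PolyDeg (n * n * (n * d)) fun x => nondegDet e (Y x) g := by
  have hcard : Fintype.card (Option (Fin m × Fin (n - 1))) = n * n := by
    rw [Fintype.card_congr e]
    simp
  rw [← hcard]
  refine PolyDeg.det fun l l' => ?_
  match l with
  | none => exact PolyDeg.const _
  | some (p, j) =>
    exact (PolyDeg.matrix_pow (PolyDeg.matrix_mul_const g (hY p)) (j + 1) _ _).mono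
      (Nat.mul_le_mul_right _ (by omega))

theorem polyDeg_tupleMatrix_left (i : ℕ) (t : Matrix (Fin n) (Fin n) L) (p : Fin (n + 1))
    (a b : Fin n) : PolyDeg n fun h => tupleMatrix i h t p a b := by
  unfold tupleMatrix
  split_ifs with hp
  · exact (PolyDeg.entry a b).mono (Nat.succ_le_of_lt (Fin.pos a))
  all_goals exact PolyDeg.const _

theorem polyDeg_tupleMatrix_right (i : ℕ) (h : Matrix (Fin n) (Fin n) L) (p : Fin (n + 1))
    (a b : Fin n) : PolyDeg n fun t => tupleMatrix i h t p a b := by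
  unfold tupleMatrix
  split_ifs with hp hi
  · exact PolyDeg.const _
  all_goals
    refine (PolyDeg.matrix_pow (fun a b => PolyDeg.entry a b) _ a b).mono ?_
    omega

theorem IsNondegenerate.conj {Y : Fin m → Matrix (Fin n) (Fin n) L}
    {g : Matrix (Fin n) (Fin n) L} (h : IsNondegenerate Y g) (γ : (Matrix (Fin n) (Fin n) L)ˣ) :
    IsNondegenerate (fun p => γ.1 * Y p * γ⁻¹.1) (γ.1 * g * γ⁻¹.1) := by
  intro δ h0 hδ
  have h1 : γ⁻¹.1 * δ * γ.1 = 0 := by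
    refine h _ ?_ fun p j hj => ?_
    · rw [Matrix.trace_mul_comm, ← mul_assoc, Units.mul_inv, one_mul, h0]
    · have h2 := hδ p j hj
      have h3 : γ.1 * Y p * γ⁻¹.1 * (γ.1 * g * γ⁻¹.1) = γ.1 * (Y p * g) * γ⁻¹.1 := by
        simp only [mul_assoc, Units.inv_mul_cancel_left]
      rw [h3, Units.conj_pow, mul_assoc, mul_assoc, Matrix.trace_mul_comm] at h2
      simpa only [mul_assoc] using h2
  have h2 : γ.1 * (γ⁻¹.1 * δ * γ.1) * γ⁻¹.1 = δ := by
    simp only [mul_assoc, Units.mul_inv_cancel_left, Units.mul_inv, mul_one]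
  rw [← h2, h1, mul_zero, zero_mul]

theorem tupleMatrix_conj (i : ℕ) (h t : Matrix (Fin n) (Fin n) L)
    (γ : (Matrix (Fin n) (Fin n) L)ˣ) :
    tupleMatrix i (γ.1 * h * γ⁻¹.1) (γ.1 * t * γ⁻¹.1) =
      fun p => γ.1 * tupleMatrix i h t p * γ⁻¹.1 := by
  ext1 p
  unfold tupleMatrix
  split_ifs
  · rfl
  all_goals rw [Units.conj_pow]

theorem exists_mem_torusOf_isNondegenerate [IsAlgClosed L] {i : ℕ} (hn : 2 ≤ n) (hi : i ≤ n)
    (γ : (Matrix (Fin n) (Fin n) L)ˣ) :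
    ∃ h g : Matrix.SpecialLinearGroup (Fin n) L, ∃ t ∈ torusOf n L γ,
      IsNondegenerate (tupleMatrix i h.1 t.1) g.1 := by
  obtain ⟨v, h, g, hv, hh, hg, hnd⟩ := exists_isNondegenerate (L := L) hn hi
  have hdet : ∀ x : Matrix (Fin n) (Fin n) L, (γ.1 * x * γ⁻¹.1).det = x.det :=
    fun x => Matrix.det_units_conj γ x
  refine ⟨⟨_, (hdet h).trans hh⟩, ⟨_, (hdet g).trans hg⟩,
    ⟨_, (hdet (Matrix.diagonal v)).trans (by rw [Matrix.det_diagonal, hv])⟩,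
    ⟨Matrix.diagonal v, Matrix.isDiag_diagonal v, rfl⟩, ?_⟩
  have := hnd.conj γ
  rwa [← tupleMatrix_conj] at this

end nondegenerate

section fibers

variable {L : Type*} [Field L]

theorem charpoly_smul_eq_of_charpoly_eq {ι : Type*} [Fintype ι] [DecidableEq ι]
    {A B : Matrix ι ι L} (h : A.charpoly = B.charpoly) (c : L) :
    (c • A).charpoly = (c • B).charpoly := by
  have key : ∀ (M : Matrix ι ι L) (k : ℕ), k ≤ Fintype.card ι →
      (c • M).charpoly.coeff k = c ^ (Fintype.card ι - k) * M.charpoly.coeff k := by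
    intro M k hk
    have hM : ∀ M : Matrix ι ι L, M.charpoly.coeff k =
        MvPolynomial.aeval (fun q : ι × ι => M q.1 q.2) ((Matrix.charpoly.univ L ι).coeff k) :=
      fun M => (Matrix.charpoly.univ_coeff_eval₂Hom ι (RingHom.id L) (fun q => M q.1 q.2) k).symm
    rw [hM, hM, ← aeval_mul_of_isHomogeneous
      (Matrix.charpoly.univ_coeff_isHomogeneous L ι k (Fintype.card ι - k) (by omega))]
    rfl
  ext k
  rcases le_or_gt k (Fintype.card ι) with hk | hk
  · rw [key A k hk, key B k hk, h]
  · rw [Polynomial.coeff_eq_zero_of_natDegree_lt (by rwa [Matrix.charpoly_natDegree_eq_dim]),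
      Polynomial.coeff_eq_zero_of_natDegree_lt (by rwa [Matrix.charpoly_natDegree_eq_dim])]

theorem charpoly_eq_of_kappa_eq {K : Type*} [Field K] {n : ℕ}
    {x y : Matrix.SpecialLinearGroup (Fin n) K} (h : kappa n K x = kappa n K y) :
    x.1.charpoly = y.1.charpoly := by
  have htop : ∀ z : Matrix.SpecialLinearGroup (Fin n) K, z.1.charpoly.coeff n = 1 := by
    intro z
    have := (Matrix.charpoly_monic z.1).coeff_natDegree
    rwa [Matrix.charpoly_natDegree_eq_dim, Fintype.card_fin] at this
  have hbot : ∀ z : Matrix.SpecialLinearGroup (Fin n) K, z.1.charpoly.coeff 0 = (-1) ^ n := by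
    intro z
    have := Matrix.det_eq_sign_charpoly_coeff z.1
    rw [z.2, Fintype.card_fin] at this
    rcases neg_one_pow_eq_or K n with h1 | h1 <;> rw [h1] at this ⊢
    · simpa using this.symm
    · linear_combination this
  ext k
  rcases lt_trichotomy k n with hk | rfl | hk
  · rcases k.eq_zero_or_pos with rfl | hk0
    · rw [hbot, hbot]
    · have := congrFun h ⟨n - 1 - k, by omega⟩
      simpa [kappa, show n - 1 - (n - 1 - k) = k by omega] using this
  · rw [htop, htop]
  · rw [Polynomial.coeff_eq_zero_of_natDegree_lt (by simpa [Matrix.charpoly_natDegree_eq_dim]),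
      Polynomial.coeff_eq_zero_of_natDegree_lt (by simpa [Matrix.charpoly_natDegree_eq_dim])]

theorem exists_ncard_charpoly_fiber_le [IsAlgClosed L] {n m : ℕ} (hn : 2 ≤ n)
    (hcard : m * (n - 1) + 1 = n * n) (Y : Fin m → Matrix (Fin n) (Fin n) L)
    {g : Matrix (Fin n) (Fin n) L} (hg : g.det = 1) (hY : IsNondegenerate Y g) :
    ∃ S : Matrix (Fin n) (Fin n) L → L,
      PolyDeg (n * n * (n * n * relationBound (n * n) n * n)) S ∧
      (∃ x : Matrix.SpecialLinearGroup (Fin n) L, S x.1 ≠ 0) ∧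
      ∀ y : Matrix.SpecialLinearGroup (Fin n) L,
        ∀ T : Set (Matrix.SpecialLinearGroup (Fin n) L),
        (∀ x ∈ T, S x.1 ≠ 0 ∧ ∀ p, (Y p * x.1).charpoly = (Y p * y.1).charpoly) →
        T.Finite ∧ T.ncard ≤ relationBound (n * n) n ^ (n * n) := by
  classical
  have : Nontrivial (Fin n) := Fin.nontrivial_iff_two_le.2 hn
  have : Infinite L := IsAlgClosed.instInfinite
  choose c S hS hS0 hZ using PolyDeg.exists_entry_mem_roots (ι := Fin n) (b := n) (N := n * n)
    (by omega) (polyDeg_charFun Y) (by simp) (by simpa using hcard)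
    (charFun_independent hcard Y g hg hY)
  refine ⟨fun x => ∏ q, S q x, ?_, PolyDeg.exists_prod_ne_zero _ (fun q _ => hS q) fun q _ => hS0 q,
    fun y T hT => ?_⟩
  · simpa using PolyDeg.prod Finset.univ fun q _ => hS q
  · choose Z hZc hZ using fun q => hZ q fun l => charFun Y l (c q • y.1)
    have hmem : ∀ x ∈ T, (fun q : Fin n × Fin n => x.1 q.1 q.2) ∈ Fintype.piFinset Z := by
      intro x hx
      obtain ⟨hSx, hch⟩ := hT x hx
      refine Fintype.mem_piFinset.2 fun q => hZ q x.1
        (Finset.prod_ne_zero_iff.1 hSx q (Finset.mem_univ q)) fun l => ?_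
      match l with
      | none => simp [charFun]
      | some (p, j) =>
        simp only [charFun, Matrix.mul_smul]
        rw [charpoly_smul_eq_of_charpoly_eq (hch p)]
    have hinj : Set.InjOn (fun (x : Matrix.SpecialLinearGroup (Fin n) L) (q : Fin n × Fin n) =>
        x.1 q.1 q.2) T := by
      intro x _ x' _ hxx
      ext a b
      exact congrFun hxx (a, b)
    have hfin : T.Finite := Set.Finite.of_injOn hmem hinj (Finset.finite_toSet _)
    refine ⟨hfin, (Set.ncard_le_ncard_of_injOn _ hmem hinj (Finset.finite_toSet _)).trans ?_⟩
    rw [Set.ncard_coe_finset, Fintype.card_piFinset]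
    refine (Finset.prod_le_pow_card _ _ _ fun q _ => hZc q).trans ?_
    simp

end fibers

section counting

theorem PolyDeg.exists_escape_mul {ι L G : Type*} [Field L] [Fintype ι] [DecidableEq ι] [Group G]
    (ρ : G →* Matrix ι ι L) (A : Set G) (d : ℕ) :
    ∃ W : Finset G, W.Nonempty ∧ W.card ≤ escapeBound (Fintype.card ι) d + 1 ∧
      (W : Set G) ⊆ prodSet A (escapeBound (Fintype.card ι) d) ∧
      ∀ F, PolyDeg d F → (∃ y ∈ Subgroup.closure A, F (ρ y) ≠ 0) →
        ∀ x ∈ Subgroup.closure A, ∃ w ∈ W, F (ρ (x * w)) ≠ 0 := by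
  classical
  obtain ⟨W, hWc, hWA, hW⟩ := PolyDeg.exists_escape ρ A d
  refine ⟨insert 1 W, Finset.insert_nonempty _ _,
    (Finset.card_insert_le _ _).trans (Nat.succ_le_succ hWc), ?_, fun F hF hy x hx => ?_⟩
  · rw [Finset.coe_insert]
    exact Set.insert_subset (one_mem_prodSet _ _) hWA
  · obtain ⟨y, hy, hFy⟩ := hy
    by_contra! h
    have hF' : PolyDeg d fun z => F (ρ x * z) := by
      simpa using hF.comp (PolyDeg.matrix_const_mul (ρ x) PolyDeg.entry)
    refine hFy ?_
    have h1 := hW _ hF' (fun w hw => ?_) (x⁻¹ * y) (mul_mem (inv_mem hx) hy)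
    · rwa [← map_mul, mul_inv_cancel_left] at h1
    · rw [← map_mul]
      exact h w (Finset.mem_insert_of_mem hw)

variable {L : Type*} [Field L] {n : ℕ}

theorem PolyDeg.exists_map_ne_zero {K : Type*} [Field K] [Fintype K] [Algebra K L] (hn : 2 ≤ n)
    {d : ℕ} (hd : d < Fintype.card K) {F : Matrix (Fin n) (Fin n) L → L} (hF : PolyDeg d F)
    (h : ∃ x : Matrix.SpecialLinearGroup (Fin n) L, F x.1 ≠ 0) :
    ∃ x : Matrix.SpecialLinearGroup (Fin n) K,
      F (Matrix.SpecialLinearGroup.map (algebraMap K L) x).1 ≠ 0 := by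
  have : Nontrivial (Fin n) := Fin.nontrivial_iff_two_le.2 hn
  obtain ⟨x, hx⟩ := h
  by_contra! h0
  exact hx (hF.eq_zero_of_forall_map hd h0 x)

theorem succ_mul_pred_add_one (hn : 2 ≤ n) : (n + 1) * (n - 1) + 1 = n * n := by
  obtain ⟨k, rfl⟩ := Nat.exists_eq_add_of_le' hn
  rw [Nat.add_sub_assoc (by norm_num)]
  ring

theorem exists_isNondegenerate_pairs [IsAlgClosed L] {K : Type*} [Field K] [Fintype K]
    [Algebra K L] {i M : ℕ} (hn : 2 ≤ n) (hi : i ≤ n) (hK : n * n * (n * n) < Fintype.card K)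
    (hM : n * n * (n * n) ≤ M) (γ : (Matrix (Fin n) (Fin n) L)ˣ)
    (E A : Set (Matrix.SpecialLinearGroup (Fin n) K)) (hA : Subgroup.closure A = ⊤)
    (hE : ∀ x ∈ E, Matrix.SpecialLinearGroup.map (algebraMap K L) x ∈ torusOf n L γ)
    (hchar : ¬ ∃ m : Fin n → ℤ, (∃ x ∈ torusOf n L γ, charOf n L γ m x ≠ 1) ∧
      (∀ j, (m j).natAbs ≤ M) ∧
      ∀ t ∈ E, charOf n L γ m (Matrix.SpecialLinearGroup.map (algebraMap K L) t) = 1) :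
    ∃ h₀ ∈ prodSet A (escapeBound n (n * n * (n * n))),
      ∃ E' ⊆ prodSet E (1 + escapeBound n (n * n * (n * n))),
        E.ncard ≤ (escapeBound n (n * n * (n * n)) + 1) ^ 2 * E'.ncard ∧
        ∀ t ∈ E', ∃ g : Matrix.SpecialLinearGroup (Fin n) L,
          IsNondegenerate (tupleMatrix i (Matrix.SpecialLinearGroup.map (algebraMap K L) h₀).1
            (Matrix.SpecialLinearGroup.map (algebraMap K L) t).1) g.1 := by
  classical
  set φ := Matrix.SpecialLinearGroup.map (n := Fin n) (algebraMap K L)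
  set ρ := (Matrix.SpecialLinearGroup.coeMonoidHom (ι := Fin n) (R := L)).comp φ
  set d := n * n * (n * n)
  have : Finite (Matrix.SpecialLinearGroup (Fin n) K) := Subtype.finite
  let e : Option (Fin (n + 1) × Fin (n - 1)) ≃ Fin n × Fin n :=
    Fintype.equivOfCardEq (by simpa using succ_mul_pred_add_one hn)
  obtain ⟨h, g, t, ht, hnd⟩ := exists_mem_torusOf_isNondegenerate (L := L) hn hi γ
  obtain ⟨V, hV0, hVc, hVE, hV⟩ := PolyDeg.exists_escape_mul ρ E d
  obtain ⟨W, hW0, hWc, hWA, hW⟩ := PolyDeg.exists_escape_mul ρ A d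
  rw [Fintype.card_fin] at hVc hVE hWc hWA
  have hFt : PolyDeg d fun x => nondegDet e (tupleMatrix i h.1 x) g.1 :=
    polyDeg_nondegDet e (polyDeg_tupleMatrix_right i h.1) g.1
  have hFh : ∀ y, PolyDeg d fun x => nondegDet e (tupleMatrix i x y) g.1 :=
    fun y => polyDeg_nondegDet e (polyDeg_tupleMatrix_left i y) g.1
  have hpair : ∀ x ∈ E, ∃ q ∈ V ×ˢ W,
      nondegDet e (tupleMatrix i (ρ q.2) (ρ (x * q.1))) g.1 ≠ 0 := by
    intro x hx
    obtain ⟨v, hv, hxv⟩ := hV _ hFt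
      (exists_mem_closure_ne_zero φ hE hM hchar hFt ht ((nondegDet_ne_zero_iff e _ _).2 hnd)) x
      (Subgroup.subset_closure hx)
    obtain ⟨y, hy⟩ := (hFh (ρ (x * v))).exists_map_ne_zero hn hK ⟨h, hxv⟩
    obtain ⟨w, hw, hxw⟩ := hW _ (hFh (ρ (x * v))) ⟨y, by simp [hA], hy⟩ 1 (one_mem _)
    rw [one_mul] at hxw
    exact ⟨(v, w), Finset.mem_product.2 ⟨hv, hw⟩, hxw⟩
  obtain ⟨⟨v, w⟩, hvw, hcard⟩ := exists_card_le_mul_ncard E E.toFinite (V ×ˢ W)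
    ((escapeBound n d + 1) ^ 2) (by
      rw [Finset.card_product, sq]
      exact Nat.mul_le_mul hVc hWc) (hV0.product hW0) _ hpair
  rw [Finset.mem_product] at hvw
  refine ⟨w, hWA hvw.2, (fun x => x * v) '' {x ∈ E |
    nondegDet e (tupleMatrix i (ρ w) (ρ (x * v))) g.1 ≠ 0}, ?_, ?_, ?_⟩
  · rintro _ ⟨x, ⟨hx, -⟩, rfl⟩
    exact mul_mem_prodSet (mem_prodSet_one hx) (hVE hvw.1)
  · rwa [Set.ncard_image_of_injective _ (mul_left_injective v)]
  · rintro _ ⟨x, ⟨-, hx⟩, rfl⟩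
    exact ⟨g, (nondegDet_ne_zero_iff e _ _).1 hx⟩

end counting

section counting

variable {n : ℕ}

theorem charpoly_tupleMatrix_eq_of_kappaTuple_eq {K L : Type*} [Field K] [Field L] [Algebra K L]
    {i : ℕ} {h₀ t x y : Matrix.SpecialLinearGroup (Fin n) K}
    (h : kappaTuple n K h₀ t i x = kappaTuple n K h₀ t i y) (p : Fin (n + 1)) :
    (tupleMatrix i (Matrix.SpecialLinearGroup.map (algebraMap K L) h₀).1
        (Matrix.SpecialLinearGroup.map (algebraMap K L) t).1 p *
      (Matrix.SpecialLinearGroup.map (algebraMap K L) x).1).charpoly =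
    (tupleMatrix i (Matrix.SpecialLinearGroup.map (algebraMap K L) h₀).1
        (Matrix.SpecialLinearGroup.map (algebraMap K L) t).1 p *
      (Matrix.SpecialLinearGroup.map (algebraMap K L) y).1).charpoly := by
  have hmap : ∀ u : Matrix.SpecialLinearGroup (Fin n) K, kappa n K (u * x) = kappa n K (u * y) →
      ((Matrix.SpecialLinearGroup.map (algebraMap K L) u).1 *
        (Matrix.SpecialLinearGroup.map (algebraMap K L) x).1).charpoly =
      ((Matrix.SpecialLinearGroup.map (algebraMap K L) u).1 *
        (Matrix.SpecialLinearGroup.map (algebraMap K L) y).1).charpoly := by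
    intro u hu
    have hz : ∀ z, (Matrix.SpecialLinearGroup.map (algebraMap K L) u).1 *
        (Matrix.SpecialLinearGroup.map (algebraMap K L) z).1 =
        (u * z).1.map (algebraMap K L) := fun z =>
      (congrArg Subtype.val (map_mul (Matrix.SpecialLinearGroup.map (algebraMap K L)) u z)).symm
    rw [hz, hz, Matrix.charpoly_map, Matrix.charpoly_map, charpoly_eq_of_kappa_eq hu]
  have hp := congrFun h p
  simp only [kappaTuple] at hp
  by_cases h0 : (p : ℕ) = 0
  · simp only [h0, if_true] at hp
    simpa only [tupleMatrix, h0, if_true] using hmap _ hp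
  · simp only [h0, if_false] at hp
    have := hmap _ hp
    simp only [map_pow, Matrix.SpecialLinearGroup.coe_pow] at this
    simpa only [tupleMatrix, h0, if_false] using this

/-- The degree of the polynomial to be avoided when counting tuples. -/
def avoidDegree (n a : ℕ) : ℕ :=
  n * n * (n * n * relationBound (n * n) n * n) + (a + (n + 1) * a)

theorem ncard_le_mul_ncard_kappaTuple {K : Type*} [Field K] [Fintype K] {a i : ℕ} (hn : 2 ≤ n)
    (hK : avoidDegree n a < Fintype.card K)
    {P : MvPolynomial (Fin n × Fin n) (AlgebraicClosure K)} (hPa : P.totalDegree ≤ a)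
    (hP : ∃ x : Matrix.SpecialLinearGroup (Fin n) (AlgebraicClosure K),
      MvPolynomial.eval (fun q => (x : Matrix (Fin n) (Fin n) (AlgebraicClosure K)) q.1 q.2) P ≠ 0)
    {A : Set (Matrix.SpecialLinearGroup (Fin n) K)} (hA : Subgroup.closure A = ⊤)
    {h₀ t : Matrix.SpecialLinearGroup (Fin n) K}
    {g : Matrix.SpecialLinearGroup (Fin n) (AlgebraicClosure K)}
    (hnd : IsNondegenerate (tupleMatrix i
      (Matrix.SpecialLinearGroup.map (algebraMap K (AlgebraicClosure K)) h₀).1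
      (Matrix.SpecialLinearGroup.map (algebraMap K (AlgebraicClosure K)) t).1) g.1) :
    A.ncard ≤ (escapeBound n (avoidDegree n a) + 1) * relationBound (n * n) n ^ (n * n) *
      (kappaTuple n K h₀ t i '' {g ∈ prodSet A (1 + escapeBound n (avoidDegree n a)) |
        evalAt n K P (h₀ * g) ≠ 0 ∧ evalAt n K P g ≠ 0 ∧
          ∀ m : ℕ, 1 ≤ m → m ≤ n → evalAt n K P (t ^ m * g) ≠ 0}).ncard := by
  classical
  have : Nontrivial (Fin n) := Fin.nontrivial_iff_two_le.2 hn
  have : Finite (Matrix.SpecialLinearGroup (Fin n) K) := Subtype.finite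
  set L := AlgebraicClosure K
  have : Infinite L := IsAlgClosed.instInfinite
  set φ := Matrix.SpecialLinearGroup.map (n := Fin n) (algebraMap K L) with hφ
  set ρ := (Matrix.SpecialLinearGroup.coeMonoidHom (ι := Fin n) (R := L)).comp φ
  obtain ⟨S, hS, hS0, hfib⟩ :=
    exists_ncard_charpoly_fiber_le hn (succ_mul_pred_add_one hn) _ g.2 hnd
  let F : Matrix.SpecialLinearGroup (Fin n) K → Matrix (Fin n) (Fin n) L → L :=
    fun u x => MvPolynomial.eval (fun q => (ρ u * x) q.1 q.2) P
  have hF : ∀ u, PolyDeg a (F u) := fun u =>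
    (PolyDeg.eval P (d := 1) (fun q => PolyDeg.matrix_const_mul (ρ u) PolyDeg.entry q.1 q.2)
      hPa).mono (by simp)
  have hF0 : ∀ u, ∃ x : Matrix.SpecialLinearGroup (Fin n) L, F u x.1 ≠ 0 := by
    intro u
    obtain ⟨x, hx⟩ := hP
    refine ⟨(φ u)⁻¹ * x, ?_⟩
    have : ρ u * ((φ u)⁻¹ * x).1 = x.1 := by
      change (φ u * ((φ u)⁻¹ * x)).1 = x.1
      rw [mul_inv_cancel_left]
    simpa only [F, this] using hx
  have hFeval : ∀ u x, F u (ρ x) = evalAt n K P (u * x) := by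
    intro u x
    simp only [F, ← map_mul]
    rfl
  have hprod : PolyDeg ((n + 1) * a) fun x => ∏ m ∈ Finset.range (n + 1), F (t ^ m) x := by
    simpa using PolyDeg.prod (Finset.range (n + 1)) (δ := fun _ => a) fun m _ => hF (t ^ m)
  have hR : PolyDeg (avoidDegree n a) fun x =>
      S x * (F h₀ x * ∏ m ∈ Finset.range (n + 1), F (t ^ m) x) := hS.mul ((hF h₀).mul hprod)
  obtain ⟨y, hy⟩ := hR.exists_map_ne_zero (K := K) hn hK
    (hS.exists_mul_ne_zero ((hF h₀).mul hprod) hS0 ((hF h₀).exists_mul_ne_zero hprod (hF0 h₀)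
      (PolyDeg.exists_prod_ne_zero _ (fun m _ => hF (t ^ m)) fun m _ => hF0 (t ^ m))))
  obtain ⟨W, hW0, hWc, hWA, hW⟩ := PolyDeg.exists_escape_mul ρ A (avoidDegree n a)
  rw [Fintype.card_fin] at hWc hWA
  obtain ⟨w, hw, hcard⟩ := exists_card_le_mul_ncard A A.toFinite W _ hWc hW0 _ fun x _ =>
    hW _ hR ⟨y, by simp [hA], hy⟩ x (by simp [hA])
  set B := {x ∈ prodSet A (1 + escapeBound n (avoidDegree n a)) |
    S (ρ x) * (F h₀ (ρ x) * ∏ m ∈ Finset.range (n + 1), F (t ^ m) (ρ x)) ≠ 0} with hB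
  have h1 : A.ncard ≤ (escapeBound n (avoidDegree n a) + 1) * B.ncard := by
    refine hcard.trans (Nat.mul_le_mul_left _ ?_)
    refine Set.ncard_le_ncard_of_injOn (fun x => x * w) (fun x hx => ?_)
      (mul_left_injective w).injOn B.toFinite
    exact ⟨mul_mem_prodSet (mem_prodSet_one hx.1) (hWA hw), hx.2⟩
  have h2 : B.ncard ≤ relationBound (n * n) n ^ (n * n) * (kappaTuple n K h₀ t i '' B).ncard := by
    refine ncard_le_mul_ncard_image B.toFinite _ _ fun y hy => ?_
    have hφinj : Function.Injective φ := by
      intro x x' hxx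
      ext p q
      have := congrArg (fun z : Matrix.SpecialLinearGroup (Fin n) L => z.1 p q) hxx
      exact (algebraMap K L).injective this
    rw [← Set.ncard_image_of_injective _ hφinj]
    refine (hfib (φ y) _ ?_).2
    rintro _ ⟨x, ⟨hx, hxy⟩, rfl⟩
    exact ⟨left_ne_zero_of_mul hx.2, charpoly_tupleMatrix_eq_of_kappaTuple_eq hxy⟩
  refine h1.trans ?_
  rw [mul_assoc]
  refine Nat.mul_le_mul_left _ (h2.trans (Nat.mul_le_mul_left _ ?_))
  refine Set.ncard_le_ncard (Set.image_mono fun x hx => ?_)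
    ((Set.toFinite _).image _)
  obtain ⟨hxA, hx⟩ := hx
  have hx1 := right_ne_zero_of_mul hx
  have hx2 := Finset.prod_ne_zero_iff.1 (right_ne_zero_of_mul hx1)
  simp only [hFeval] at hx1 hx2
  refine ⟨hxA, left_ne_zero_of_mul hx1, by simpa using hx2 0 (by simp), fun m _ hm =>
    hx2 m (by simp; omega)⟩

end counting

/-- Key dichotomy (c.f. Prop. 3.4 of the paper): for `n ≥ 2` there are `k, M ≥ 1` and
`c > 0` such that for every degree bound `a ≥ 1` there are `k' ≥ 1` and `c', e > 0` with:
for every large enough finite field `K`, every nonzero polynomial `P` of degree `≤ a` not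
vanishing identically on `SL_n` over `K̄`, every maximal torus `T = γ D γ⁻¹` over `K̄`,
every `E ⊆ T(K)`, every generating set `A` of `SL_n(K)`, and every `0 ≤ i ≤ n`: either
(1) there are `h₀ ∈ A_k` and `E' ⊆ E_k` with `|E'| ≥ c|E|` such that for each `t ∈ E'`
at least `c'|A|` distinct tuples `(κ(h₀g), κ(g), κ(tg), …, κ(tⁿg))` (with `κ(t^i g)`
omitted) arise from `g ∈ A_{k'}` with `P(h₀g), P(g), P(t^m g) ≠ 0` (`m = 1,…,n`); or
(2) `E` is contained in the kernel of a nontrivial character of `T` with exponents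
bounded by `M`. -/
theorem statement_14 (n : ℕ) (hn : 2 ≤ n) :
    ∃ (k M : ℕ) (c : ℝ), 0 < k ∧ 0 < M ∧ 0 < c ∧
      ∀ a : ℕ, 0 < a →
        ∃ (k' : ℕ) (c' e : ℝ), 0 < k' ∧ 0 < c' ∧ 0 < e ∧
          ∀ (K : Type) [Field K] [Fintype K], e < (Fintype.card K : ℝ) →
            ∀ P : MvPolynomial (Fin n × Fin n) (AlgebraicClosure K),
              P ≠ 0 → P.totalDegree ≤ a →
              (∃ x : Matrix.SpecialLinearGroup (Fin n) (AlgebraicClosure K),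
                MvPolynomial.eval (fun q =>
                  (x : Matrix (Fin n) (Fin n) (AlgebraicClosure K)) q.1 q.2) P ≠ 0) →
              ∀ γ : (Matrix (Fin n) (Fin n) (AlgebraicClosure K))ˣ,
                ∀ E : Set (Matrix.SpecialLinearGroup (Fin n) K),
                  E ⊆ {x | Matrix.SpecialLinearGroup.map (algebraMap K (AlgebraicClosure K)) x ∈
                    torusOf n (AlgebraicClosure K) γ} →
                  ∀ A : Set (Matrix.SpecialLinearGroup (Fin n) K),
                    Subgroup.closure A = ⊤ →
                    ∀ i : ℕ, i ≤ n →
                      -- (1)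
                      (∃ h₀ ∈ prodSet A k, ∃ E' : Set (Matrix.SpecialLinearGroup (Fin n) K),
                        E' ⊆ prodSet E k ∧ c * (E.ncard : ℝ) ≤ (E'.ncard : ℝ) ∧
                        ∀ t ∈ E',
                          c' * (A.ncard : ℝ) ≤
                            ((kappaTuple n K h₀ t i ''
                              {g ∈ prodSet A k' | evalAt n K P (h₀ * g) ≠ 0 ∧
                                evalAt n K P g ≠ 0 ∧
                                ∀ m : ℕ, 1 ≤ m → m ≤ n →
                                  evalAt n K P (t ^ m * g) ≠ 0}).ncard : ℝ)) ∨
                      -- (2)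
                      (∃ m : Fin n → ℤ,
                        (∃ x ∈ torusOf n (AlgebraicClosure K) γ,
                          charOf n (AlgebraicClosure K) γ m x ≠ 1) ∧
                        (∀ j, (m j).natAbs ≤ M) ∧
                        ∀ t ∈ E,
                          charOf n (AlgebraicClosure K) γ m
                            (Matrix.SpecialLinearGroup.map
                              (algebraMap K (AlgebraicClosure K)) t) = 1) := by
  have hd : 0 < n * n * (n * n) := by positivity
  have hinv : ∀ {D x y : ℕ}, 0 < D → x ≤ D * y → (D : ℝ)⁻¹ * x ≤ y := by
    intro D x y hD h
    rw [inv_mul_le_iff₀ (by exact_mod_cast hD)]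
    exact_mod_cast h
  refine ⟨1 + escapeBound n (n * n * (n * n)), n * n * (n * n),
    (((escapeBound n (n * n * (n * n)) + 1) ^ 2 : ℕ) : ℝ)⁻¹, by omega, hd, by positivity,
    fun a _ => ⟨1 + escapeBound n (avoidDegree n a),
      (((escapeBound n (avoidDegree n a) + 1) * relationBound (n * n) n ^ (n * n) : ℕ) : ℝ)⁻¹,
      ((n * n * (n * n) + avoidDegree n a : ℕ) : ℝ), by omega, ?_, by positivity, ?_⟩⟩
  · have : 0 < relationBound (n * n) n := Nat.succ_pos _
    positivity
  intro K _ _ hK P _ hPa hP γ E hE A hA i hi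
  have hK : n * n * (n * n) + avoidDegree n a < Fintype.card K := by exact_mod_cast hK
  rw [or_iff_not_imp_right]
  intro hchar
  obtain ⟨h₀, hh₀, E', hE', hcard, hnd⟩ := exists_isNondegenerate_pairs hn hi (by omega) le_rfl γ
    E A hA (fun x hx => hE hx) hchar
  refine ⟨h₀, prodSet_mono A (by omega) hh₀, E', hE', hinv (by positivity) hcard, fun t ht => ?_⟩
  obtain ⟨g, hg⟩ := hnd t ht
  have : 0 < relationBound (n * n) n := Nat.succ_pos _
  exact hinv (by positivity) (ncard_le_mul_ncard_kappaTuple hn (by omega) hPa hP hA hg)
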